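/- Let λ > 0 and 0 < α < 1, and set η = (1/3)·(3−2α)/(5−2α). There are constants b₀ > 0 and b₁₁, b₁₂ > 0 (the latter two depending on α and λ) such that for every finite connected transitive graph 𝔾 satisfying the triangle condition ∇_{p_c}(x,y) ≤ δ_{x,y} + a₀ with a₀ ≤ b₀ and λV^{1/3} ≥ b₀^{-1}, and for p = p_c + εΩ^{-1} with max{b₁₂V^{-1/3}, V^{-η}} ≤ ε ≤ 1: ℙ_p(|C_max| ≤ [1 + (εV^η)^{-1}]·θ_α(p)·V) ≥ 1 − b₁₁/(εV^η)^{3−2α}. -/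

import Mathlib

noncomputable section
open Classical

namespace Percolation

variable {V : Type*} [Fintype V] [DecidableEq V]

/-- A percolation configuration: an assignment of occupied (`true`) or
vacant (`false`) to each bond of the graph. -/
def Config (G : SimpleGraph V) : Type _ := G.edgeSet → Bool

noncomputable instance (G : SimpleGraph V) : Fintype G.edgeSet :=
  Fintype.ofFinite _

noncomputable instance (G : SimpleGraph V) : Fintype (Config G) :=
  inferInstanceAs (Fintype (G.edgeSet → Bool))

/-- The probability weight of a configuration under the product Bernoulli
measure with parameter `p`. -/
def weight (G : SimpleGraph V) (p : ℝ) (ω : Config G) : ℝ :=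
  ∏ e : G.edgeSet, if ω e then p else 1 - p

/-- The probability of an event under the percolation measure `ℙ_p`. -/
def prob (G : SimpleGraph V) (p : ℝ) (A : Config G → Prop) : ℝ :=
  ∑ ω : Config G, if A ω then weight G p ω else 0

/-- The expectation of a random variable under the percolation measure `ℙ_p`. -/
def expect (G : SimpleGraph V) (p : ℝ) (f : Config G → ℝ) : ℝ :=
  ∑ ω : Config G, weight G p ω * f ω

/-- The subgraph consisting of the occupied bonds of a configuration. -/
def occupied (G : SimpleGraph V) (ω : Config G) : SimpleGraph V :=
  SimpleGraph.fromEdgeSet {e | ∃ h : e ∈ G.edgeSet, ω ⟨e, h⟩ = true}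

/-- The cluster `C(x)` of the vertex `x`: all vertices joined to `x` by a path
of occupied bonds (including `x` itself). -/
def cluster (G : SimpleGraph V) (ω : Config G) (x : V) : Finset V :=
  Finset.univ.filter fun y => (occupied G ω).Reachable x y

/-- The susceptibility `χ(p)`: the expected size of the cluster of `x₀`. -/
def chi (G : SimpleGraph V) (x₀ : V) (p : ℝ) : ℝ :=
  expect G p fun ω => ((cluster G ω x₀).card : ℝ)

/-- The two-point function `τ_p(x,y) = ℙ_p(x ↔ y)`. -/
def tau (G : SimpleGraph V) (p : ℝ) (x y : V) : ℝ :=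
  prob G p fun ω => (occupied G ω).Reachable x y

/-- The triangle diagram `∇_p(x,y)`. -/
def triangle (G : SimpleGraph V) (p : ℝ) (x y : V) : ℝ :=
  ∑ u : V, ∑ v : V, tau G p x u * tau G p u v * tau G p v y

/-- The Kronecker delta `δ_{x,y}`. -/
def kron (x y : V) : ℝ := if x = y then 1 else 0

/-- `∇̄_p`: the maximum of the triangle diagram over bonds `{x,y} ∈ 𝔹`. -/
def nablaBar (G : SimpleGraph V) (p : ℝ) : ℝ :=
  sSup {t : ℝ | ∃ x y : V, G.Adj x y ∧ t = triangle G p x y}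

/-- A graph is (vertex-)transitive if any vertex can be mapped to any other
by a graph automorphism. -/
def IsTransitive (G : SimpleGraph V) : Prop :=
  ∀ x y : V, ∃ φ : G ≃g G, φ x = y

/-- The size `|C_max|` of the largest cluster. -/
def maxCluster (G : SimpleGraph V) (ω : Config G) : ℕ :=
  Finset.univ.sup fun x => (cluster G ω x).card

/-- The cluster size distribution `P_{≥k}(p) = ℙ_p(|C(x₀)| ≥ k)`. -/
def Pgeq (G : SimpleGraph V) (x₀ : V) (p : ℝ) (k : ℝ) : ℝ :=
  prob G p fun ω => k ≤ ((cluster G ω x₀).card : ℝ)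

/-- The magnetization `M(p,γ)`. -/
def magnetization (G : SimpleGraph V) (x₀ : V) (p γ : ℝ) : ℝ :=
  ∑ k ∈ Finset.Icc 1 (Fintype.card V),
    (1 - (1 - γ) ^ k) * prob G p fun ω => (cluster G ω x₀).card = k

/-- `Z_{≥s}`: the number of vertices lying in clusters of size at least `s`. -/
def Zgeq (G : SimpleGraph V) (s : ℝ) (ω : Config G) : ℝ :=
  ∑ x : V, if s ≤ ((cluster G ω x).card : ℝ) then (1 : ℝ) else 0

/-- The variance of a random variable under `ℙ_p`. -/
def variance (G : SimpleGraph V) (p : ℝ) (f : Config G → ℝ) : ℝ :=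
  expect G p (fun ω => f ω ^ 2) - (expect G p f) ^ 2

/-- The restricted susceptibility `χ_{≥s}(p) = 𝔼_p[|C(x₀)| I[|C(x₀)| ≥ s]]`. -/
def chiGeq (G : SimpleGraph V) (x₀ : V) (p : ℝ) (s : ℝ) : ℝ :=
  expect G p fun ω =>
    if s ≤ ((cluster G ω x₀).card : ℝ) then ((cluster G ω x₀).card : ℝ) else 0

/-- The restricted susceptibility `χ_{<s}(p) = 𝔼_p[|C(x₀)| I[|C(x₀)| < s]]`. -/
def chiLt (G : SimpleGraph V) (x₀ : V) (p : ℝ) (s : ℝ) : ℝ :=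
  expect G p fun ω =>
    if ((cluster G ω x₀).card : ℝ) < s then ((cluster G ω x₀).card : ℝ) else 0

end Percolation

namespace PercAux

section Abstract

variable {ι : Type*} [Fintype ι]

/-- Bernoulli weight of a configuration. -/
def wt (p : ℝ) (ω : ι → Bool) : ℝ := ∏ e, if ω e then p else 1 - p

/-- Expectation for the product Bernoulli measure. -/
def Ex (p : ℝ) (f : (ι → Bool) → ℝ) : ℝ := ∑ ω, wt p ω * f ω

/-- Real indicator of a proposition. -/
def ind (P : Prop) : ℝ := if P then 1 else 0

lemma ind_nonneg (P : Prop) : 0 ≤ ind P := by unfold ind; split_ifs <;> norm_num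
lemma ind_le_one (P : Prop) : ind P ≤ 1 := by unfold ind; split_ifs <;> norm_num
lemma ind_true {P : Prop} (h : P) : ind P = 1 := by simp [ind, h]
lemma ind_false {P : Prop} (h : ¬ P) : ind P = 0 := by simp [ind, h]
lemma ind_mono {P Q : Prop} (h : P → Q) : ind P ≤ ind Q := by
  by_cases hP : P
  · simp [ind, hP, h hP]
  · rw [ind_false hP]; exact ind_nonneg Q
lemma ind_congr {P Q : Prop} (h : P ↔ Q) : ind P = ind Q := by
  simp [ind, h]
lemma ind_and (P Q : Prop) : ind (P ∧ Q) = ind P * ind Q := by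
  by_cases hP : P <;> by_cases hQ : Q <;> simp [ind, hP, hQ]

lemma wt_nonneg {p : ℝ} (h0 : 0 ≤ p) (h1 : p ≤ 1) (ω : ι → Bool) : 0 ≤ wt p ω := by
  unfold wt
  apply Finset.prod_nonneg
  intro e _
  split_ifs <;> linarith

lemma Ex_mono {p : ℝ} (h0 : 0 ≤ p) (h1 : p ≤ 1) {f g : (ι → Bool) → ℝ}
    (h : ∀ ω, f ω ≤ g ω) : Ex p f ≤ Ex p g :=
  Finset.sum_le_sum fun ω _ => mul_le_mul_of_nonneg_left (h ω) (wt_nonneg h0 h1 ω)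

lemma Ex_nonneg {p : ℝ} (h0 : 0 ≤ p) (h1 : p ≤ 1) {f : (ι → Bool) → ℝ}
    (h : ∀ ω, 0 ≤ f ω) : 0 ≤ Ex p f :=
  Finset.sum_nonneg fun ω _ => mul_nonneg (wt_nonneg h0 h1 ω) (h ω)

lemma Ex_add (p : ℝ) (f g : (ι → Bool) → ℝ) :
    Ex p (fun ω => f ω + g ω) = Ex p f + Ex p g := by
  simp [Ex, mul_add, Finset.sum_add_distrib]

lemma Ex_sub (p : ℝ) (f g : (ι → Bool) → ℝ) :
    Ex p (fun ω => f ω - g ω) = Ex p f - Ex p g := by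
  simp [Ex, mul_sub, Finset.sum_sub_distrib]

lemma Ex_mul_left (p c : ℝ) (f : (ι → Bool) → ℝ) :
    Ex p (fun ω => c * f ω) = c * Ex p f := by
  simp only [Ex, Finset.mul_sum]
  exact Finset.sum_congr rfl fun ω _ => by ring

lemma Ex_mul_right (p c : ℝ) (f : (ι → Bool) → ℝ) :
    Ex p (fun ω => f ω * c) = Ex p f * c := by
  simp only [Ex, Finset.sum_mul]
  exact Finset.sum_congr rfl fun ω _ => by ring

lemma Ex_sum {α : Type*} (p : ℝ) (s : Finset α) (f : α → (ι → Bool) → ℝ) :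
    Ex p (fun ω => ∑ a ∈ s, f a ω) = ∑ a ∈ s, Ex p (f a) := by
  simp only [Ex, Finset.mul_sum]
  exact Finset.sum_comm

lemma Ex_one (p : ℝ) : Ex p (fun _ : ι → Bool => (1 : ℝ)) = 1 := by
  have h := Finset.prod_univ_sum (ι := ι) (κ := fun _ => Bool)
    (fun _ => (Finset.univ : Finset Bool)) (fun _ b => if b then p else 1 - p)
  simp only [Ex, wt, mul_one]
  have h2 : (Fintype.piFinset fun _ : ι => (Finset.univ : Finset Bool)) = Finset.univ := by
    ext; simp
  rw [h2] at h
  rw [← h]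
  simp

lemma Ex_const (p c : ℝ) : Ex p (fun _ : ι → Bool => c) = c := by
  have := Ex_mul_left (ι := ι) p c (fun _ => 1)
  rw [Ex_one] at this
  simpa using this

/-- flip one coordinate -/
def flip (e : ι) (ω : ι → Bool) : ι → Bool := Function.update ω e (!ω e)

lemma flip_flip (e : ι) (ω : ι → Bool) : flip e (flip e ω) = ω := by
  ext i
  by_cases h : i = e
  · subst h; simp [flip]
  · simp [flip, h]

/-- weight without the coordinate `e` -/
lemma wt_update (p : ℝ) (e : ι) (ω : ι → Bool) (b : Bool) :
    wt p (Function.update ω e b) =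
      (if b then p else 1 - p) * ∏ j ∈ Finset.univ.erase e, if ω j then p else 1 - p := by
  unfold wt
  rw [← Finset.mul_prod_erase Finset.univ _ (Finset.mem_univ e)]
  simp only [Function.update_self]
  congr 1
  apply Finset.prod_congr rfl
  intro j hj
  rw [Function.update_of_ne (Finset.ne_of_mem_erase hj)]

lemma sum_split (e : ι) (F : (ι → Bool) → ℝ) :
    2 * ∑ ω, F ω = ∑ ω, (F (Function.update ω e true) + F (Function.update ω e false)) := by
  have h1 : ∑ ω, F ω = ∑ ω, F (flip e ω) :=
    (Equiv.sum_comp (⟨flip e, flip e, flip_flip e, flip_flip e⟩ :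
      (ι → Bool) ≃ (ι → Bool)) F).symm
  have h2 : ∑ ω, (F ω + F (flip e ω)) = 2 * ∑ ω, F ω := by
    rw [Finset.sum_add_distrib, ← h1]; ring
  rw [← h2]
  apply Finset.sum_congr rfl
  intro ω _
  unfold flip
  cases h : ω e
  · have : Function.update ω e false = ω := by rw [← h]; exact Function.update_eq_self _ _
    simp [this, add_comm]
  · have : Function.update ω e true = ω := by rw [← h]; exact Function.update_eq_self _ _
    simp [this]

/-- splitting the expectation at one coordinate -/
lemma Ex_split (p : ℝ) (e : ι) (f : (ι → Bool) → ℝ) :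
    Ex p f = Ex p (fun ω => p * f (Function.update ω e true) +
      (1 - p) * f (Function.update ω e false)) := by
  have h1 := sum_split e (fun ω => wt p ω * f ω)
  have h2 := sum_split e (fun ω => wt p ω * (p * f (Function.update ω e true) +
      (1 - p) * f (Function.update ω e false)))
  unfold Ex
  have : ∀ a b : ℝ, 2 * a = 2 * b → a = b := fun a b h => by linarith
  apply this
  rw [h1, h2]
  apply Finset.sum_congr rfl
  intro ω _
  simp only [wt_update, Function.update_idem]
  simp
  ring

/-- Mean zero increments. -/
lemma Ex_centered (p : ℝ) (e : ι) (f : (ι → Bool) → ℝ) :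
    Ex p (fun ω => ((if ω e then 1 else 0) - p) * f ω) =
      p * (1 - p) * Ex p (fun ω => f (Function.update ω e true) -
        f (Function.update ω e false)) := by
  rw [Ex_split p e, ← Ex_mul_left]
  congr 1
  ext ω
  simp
  ring

lemma Ex_closed (p : ℝ) (e : ι) (f : (ι → Bool) → ℝ) :
    Ex p (fun ω => (if ω e then 0 else 1) * f ω) =
      (1 - p) * Ex p (fun ω => f (Function.update ω e false)) := by
  rw [Ex_split p e, ← Ex_mul_left]
  congr 1
  ext ω
  simp

lemma Ex_open (p : ℝ) (e : ι) (f : (ι → Bool) → ℝ) :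
    Ex p (fun ω => (if ω e then 1 else 0) * f ω) =
      p * Ex p (fun ω => f (Function.update ω e true)) := by
  rw [Ex_split p e, ← Ex_mul_left]
  congr 1
  ext ω
  simp

lemma prod_erase_sum (p : ℝ) (e : ι) (f : (ι → Bool) → ℝ) :
    ∑ ω, (∏ j ∈ Finset.univ.erase e, if ω j then p else 1 - p) *
      (if ω e then 1 else -1) * f ω =
    Ex p (fun ω => f (Function.update ω e true) - f (Function.update ω e false)) := by
  have h1 := sum_split e (fun ω : ι → Bool =>
    (∏ j ∈ Finset.univ.erase e, if ω j then p else 1 - p) *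
      (if ω e then (1:ℝ) else -1) * f ω)
  have h2 := sum_split e (fun ω : ι → Bool => wt p ω *
    (f (Function.update ω e true) - f (Function.update ω e false)))
  unfold Ex
  have : ∀ a b : ℝ, 2 * a = 2 * b → a = b := fun a b h => by linarith
  apply this
  rw [h1, h2]
  apply Finset.sum_congr rfl
  intro ω _
  have h3 : ∀ b : Bool, (∏ j ∈ Finset.univ.erase e, if Function.update ω e b j then p else 1 - p)
      = ∏ j ∈ Finset.univ.erase e, if ω j then p else 1 - p := by
    intro b
    apply Finset.prod_congr rfl
    intro j hj
    rw [Function.update_of_ne (Finset.ne_of_mem_erase hj)]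
  simp only [wt_update, Function.update_idem, h3]
  simp
  ring

/-- Russo's formula. -/
lemma russo (p : ℝ) (f : (ι → Bool) → ℝ) :
    HasDerivAt (fun q => Ex q f)
      (∑ e, Ex p (fun ω => f (Function.update ω e true) - f (Function.update ω e false))) p := by
  have h : ∀ ω : ι → Bool, HasDerivAt (fun q => wt q ω * f ω)
      ((∑ e, (∏ j ∈ Finset.univ.erase e, if ω j then p else 1 - p) *
        (if ω e then 1 else -1)) * f ω) p := by
    intro ω
    apply HasDerivAt.mul_const
    unfold wt
    have h0 : ∀ e ∈ (Finset.univ : Finset ι),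
        HasDerivAt (fun q : ℝ => if ω e then q else 1 - q) (if ω e then 1 else -1) p := by
      intro e _
      split_ifs
      · exact hasDerivAt_id p
      · simpa using (hasDerivAt_id p).const_sub 1
    have := HasDerivAt.fun_finsetProd h0
    simpa [smul_eq_mul] using this
  have h1 := HasDerivAt.fun_sum (u := (Finset.univ : Finset (ι → Bool))) (fun ω _ => h ω)
  have h2 : (∑ e, Ex p (fun ω => f (Function.update ω e true) - f (Function.update ω e false))) =
      ∑ ω, (∑ e, (∏ j ∈ Finset.univ.erase e, if ω j then p else 1 - p) *
        (if ω e then 1 else -1)) * f ω := by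
    simp only [Finset.sum_mul]
    rw [Finset.sum_comm]
    apply Finset.sum_congr rfl
    intro e _
    exact (prod_erase_sum p e f).symm
  rw [h2]
  exact h1

lemma Ex_monotoneOn {f : (ι → Bool) → ℝ} (hf : Monotone f) :
    MonotoneOn (fun q => Ex q f) (Set.Icc 0 1) := by
  apply monotoneOn_of_deriv_nonneg (convex_Icc 0 1)
  · exact fun x _ => (russo x f).continuousAt.continuousWithinAt
  · exact fun x _ => (russo x f).differentiableAt.differentiableWithinAt
  · intro x hx
    rw [interior_Icc] at hx
    rw [(russo x f).deriv]
    apply Finset.sum_nonneg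
    intro e _
    apply Ex_nonneg hx.1.le hx.2.le
    intro ω
    have : Function.update ω e false ≤ Function.update ω e true := by
      intro i
      by_cases h : i = e
      · subst h; simp
      · simp [h]
    linarith [hf this]

lemma Ex_mono_p {f : (ι → Bool) → ℝ} (hf : Monotone f) {p q : ℝ} (h0 : 0 ≤ p) (h : p ≤ q)
    (h1 : q ≤ 1) : Ex p f ≤ Ex q f :=
  Ex_monotoneOn hf ⟨h0, h.trans h1⟩ ⟨h0.trans h, h1⟩ h

/-- Independence of functions of disjoint sets of coordinates. -/
lemma Ex_indep (p : ℝ) (F : ι → Prop) (f g : (ι → Bool) → ℝ)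
    (hf : ∀ ω ω' : ι → Bool, (∀ e, F e → ω e = ω' e) → f ω = f ω')
    (hg : ∀ ω ω' : ι → Bool, (∀ e, ¬ F e → ω e = ω' e) → g ω = g ω') :
    Ex p (fun ω => f ω * g ω) = Ex p f * Ex p g := by
  have key : Ex p f * Ex p g =
      ∑ x : (ι → Bool) × (ι → Bool), wt p x.1 * wt p x.2 * (f x.1 * g x.2) := by
    rw [Fintype.sum_prod_type]
    unfold Ex
    rw [Finset.sum_mul_sum]
    exact Finset.sum_congr rfl fun a _ => Finset.sum_congr rfl fun b _ => by ring
  have key2 : Ex p (fun ω => f ω * g ω) =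
      ∑ x : (ι → Bool) × (ι → Bool), wt p x.1 * wt p x.2 * (f x.1 * g x.1) := by
    rw [Fintype.sum_prod_type]
    have h1 := Ex_one (ι := ι) p
    unfold Ex at *
    apply Finset.sum_congr rfl
    intro a _
    rw [← mul_one (wt p a * (f a * g a)), ← h1, Finset.mul_sum]
    exact Finset.sum_congr rfl fun b _ => by ring
  rw [key, key2]
  let sw : (ι → Bool) × (ι → Bool) → (ι → Bool) × (ι → Bool) := fun x =>
    (fun e => if F e then x.1 e else x.2 e, fun e => if F e then x.2 e else x.1 e)
  have hsw : ∀ x, sw (sw x) = x := by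
    intro x
    apply Prod.ext <;> (ext e; by_cases h : F e <;> simp [sw, h])
  rw [← Equiv.sum_comp (⟨sw, sw, hsw, hsw⟩ : ((ι → Bool) × (ι → Bool)) ≃ _)]
  apply Finset.sum_congr rfl
  intro x _
  have e1 : f (sw x).1 = f x.1 := hf _ _ fun e he => by simp [sw, he]
  have e2 : g (sw x).1 = g x.2 := hg _ _ fun e he => by simp [sw, he]
  have e3 : wt p (sw x).1 * wt p (sw x).2 = wt p x.1 * wt p x.2 := by
    unfold wt
    rw [← Finset.prod_mul_distrib, ← Finset.prod_mul_distrib]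
    apply Finset.prod_congr rfl
    intro e _
    by_cases h : F e
    · simp [sw, h]
    · simp only [sw, h, if_false]; ring
  simp only [Equiv.coe_fn_mk, e1, e2, e3]

/-- Disjoint occurrence. -/
def Disj (A B : (ι → Bool) → Prop) (ω : ι → Bool) : Prop :=
  ∃ s t : ι → Bool, (∀ i, s i = true → ω i = true) ∧ (∀ i, t i = true → ω i = true) ∧
    (∀ i, ¬ (s i = true ∧ t i = true)) ∧ A s ∧ B t

/-- interpolation event for the BK inequality -/
def JK (A B : (ι → Bool) → Prop) (K : Finset ι) (ω ω' : ι → Bool) : Prop :=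
  ∃ s t : ι → Bool, (∀ i, s i = true → ω i = true) ∧
    (∀ i, t i = true → if i ∈ K then ω' i = true else ω i = true) ∧
    (∀ i, i ∉ K → ¬ (s i = true ∧ t i = true)) ∧ A s ∧ B t

lemma JK_step {p : ℝ} (h0 : 0 ≤ p) (h1 : p ≤ 1) (A B : (ι → Bool) → Prop) (K : Finset ι)
    (e : ι) (he : e ∉ K) :
    Ex p (fun ω => Ex p (fun ω' => ind (JK A B K ω ω'))) ≤
      Ex p (fun ω => Ex p (fun ω' => ind (JK A B (insert e K) ω ω'))) := by
  rw [Ex_split p e, Ex_split p e (fun ω => Ex p (fun ω' => ind (JK A B (insert e K) ω ω')))]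
  apply Ex_mono h0 h1
  intro ω
  rw [Ex_split p e (fun ω' => ind (JK A B (insert e K) (Function.update ω e true) ω')),
    Ex_split p e (fun ω' => ind (JK A B (insert e K) (Function.update ω e false) ω')),
    ← Ex_mul_left, ← Ex_mul_left, ← Ex_mul_left, ← Ex_mul_left, ← Ex_add, ← Ex_add]
  apply Ex_mono h0 h1
  intro ω'
  -- the basic predicate
  let Q : Bool → Bool → Prop := fun a b => JK A B (insert e K) (Function.update ω e a)
    (Function.update ω' e b)
  have hQ : ∀ a b a' b' : Bool, a ≤ a' → b ≤ b' → Q a b → Q a' b' := by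
    rintro a b a' b' haa hbb ⟨s, t, hs, ht, hd, hA, hB⟩
    refine ⟨s, t, ?_, ?_, hd, hA, hB⟩
    · intro i hi
      have := hs i hi
      by_cases hie : i = e
      · subst hie; simp at this ⊢; subst this; revert haa; cases a' <;> simp
      · simpa [hie] using this
    · intro i hi
      have := ht i hi
      by_cases hie : i = e
      · subst hie; simp at this ⊢; subst this; revert hbb; cases b' <;> simp
      · simpa [hie] using this
  have hT : JK A B K (Function.update ω e true) ω' → Q true false ∨ Q false true := by
    rintro ⟨s, t, hs, ht, hd, hA, hB⟩
    by_cases hse : s e = true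
    · left
      refine ⟨s, t, hs, ?_, ?_, hA, hB⟩
      · intro i hi
        have := ht i hi
        by_cases hie : i = e
        · subst hie; exact absurd ⟨hse, hi⟩ (hd i he)
        · simpa [hie] using this
      · intro i hi
        exact hd i (fun h => hi (Finset.mem_insert_of_mem h))
    · right
      refine ⟨s, t, ?_, ?_, ?_, hA, hB⟩
      · intro i hi
        have := hs i hi
        by_cases hie : i = e
        · subst hie; exact absurd hi hse
        · simpa [hie] using this
      · intro i hi
        have := ht i hi
        by_cases hie : i = e
        · subst hie; simp
        · simpa [hie] using this
      · intro i hi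
        exact hd i (fun h => hi (Finset.mem_insert_of_mem h))
  have hF : JK A B K (Function.update ω e false) ω' → Q false false := by
    rintro ⟨s, t, hs, ht, hd, hA, hB⟩
    refine ⟨s, t, hs, ?_, ?_, hA, hB⟩
    · intro i hi
      have := ht i hi
      by_cases hie : i = e
      · subst hie; simp [he] at this
      · simpa [hie] using this
    · intro i hi
      exact hd i (fun h => hi (Finset.mem_insert_of_mem h))
  have d1 : ind (JK A B K (Function.update ω e true) ω') ≤ ind (Q true false ∨ Q false true) :=
    ind_mono hT
  have d2 : ind (JK A B K (Function.update ω e false) ω') ≤ ind (Q false false) :=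
    ind_mono hF
  have d3 : p * ind (Q true false ∨ Q false true) + (1 - p) * ind (Q false false) ≤
      p * (p * ind (Q true true) + (1 - p) * ind (Q true false)) +
      (1 - p) * (p * ind (Q false true) + (1 - p) * ind (Q false false)) := by
    by_cases c00 : Q false false
    · have c1 := hQ _ _ true true (by decide) (by decide) c00
      have c2 := hQ _ _ true false (by decide) (by decide) c00
      have c3 := hQ _ _ false true (by decide) (by decide) c00
      simp only [ind, c00, c1, c2, c3, true_or, if_true]; nlinarith
    · by_cases c10 : Q true false
      · have c1 := hQ _ _ true true (by decide) (by decide) c10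
        by_cases c01 : Q false true
        · simp only [ind, c00, c1, c10, c01, true_or, if_true, if_false]; nlinarith
        · simp only [ind, c00, c1, c10, c01, true_or, if_true, if_false]; nlinarith
      · by_cases c01 : Q false true
        · have c1 := hQ _ _ true true (by decide) (by decide) c01
          simp only [ind, c00, c1, c10, c01, or_true, if_true, if_false]; nlinarith
        · simp only [ind, c00, c10, c01, or_self, if_false]
          have := ind_nonneg (Q true true)
          unfold ind at this
          have := mul_nonneg h0 (mul_nonneg h0 this)
          linarith
  calc _ ≤ p * ind (Q true false ∨ Q false true) + (1 - p) * ind (Q false false) := by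
        gcongr
    _ ≤ _ := d3

/-- The van den Berg--Kesten inequality for increasing events. -/
lemma BK {p : ℝ} (h0 : 0 ≤ p) (h1 : p ≤ 1) (A B : (ι → Bool) → Prop)
    (hA : ∀ ω ω' : ι → Bool, (∀ i, ω i = true → ω' i = true) → A ω → A ω')
    (hB : ∀ ω ω' : ι → Bool, (∀ i, ω i = true → ω' i = true) → B ω → B ω') :
    Ex p (fun ω => ind (Disj A B ω)) ≤ Ex p (fun ω => ind (A ω)) * Ex p (fun ω => ind (B ω)) := by
  have step : ∀ K : Finset ι, Ex p (fun ω => Ex p (fun ω' => ind (JK A B ∅ ω ω'))) ≤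
      Ex p (fun ω => Ex p (fun ω' => ind (JK A B K ω ω'))) := by
    intro K
    induction K using Finset.induction_on with
    | empty => exact le_rfl
    | insert e K he ih => exact ih.trans (JK_step h0 h1 A B K e he)
  calc Ex p (fun ω => ind (Disj A B ω)) =
        Ex p (fun ω => Ex p (fun ω' => ind (JK A B ∅ ω ω'))) := by
        congr 1; ext ω
        have : ∀ ω', ind (JK A B ∅ ω ω') = ind (Disj A B ω) := by
          intro ω'; apply ind_congr; simp [JK, Disj]
        simp only [this, Ex_const]
    _ ≤ _ := step Finset.univ
    _ ≤ Ex p (fun ω => Ex p (fun ω' => ind (A ω) * ind (B ω'))) := by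
        apply Ex_mono h0 h1; intro ω
        apply Ex_mono h0 h1; intro ω'
        rw [← ind_and]
        apply ind_mono
        rintro ⟨s, t, hs, ht, -, hAs, hBt⟩
        exact ⟨hA _ _ hs hAs, hB _ _ (fun i hi => by simpa using ht i hi) hBt⟩
    _ = _ := by
        simp only [Ex_mul_left, Ex_mul_right]

lemma ex_cs {p : ℝ} (h0 : 0 ≤ p) (h1 : p ≤ 1) (f g : (ι → Bool) → ℝ) :
    (Ex p (fun ω => f ω * g ω)) ^ 2 ≤ Ex p (fun ω => f ω ^ 2) * Ex p (fun ω => g ω ^ 2) := by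
  have := Finset.sum_mul_sq_le_sq_mul_sq (Finset.univ : Finset (ι → Bool))
    (fun ω => Real.sqrt (wt p ω) * f ω) (fun ω => Real.sqrt (wt p ω) * g ω)
  have hs : ∀ ω : ι → Bool, Real.sqrt (wt p ω) * Real.sqrt (wt p ω) = wt p ω :=
    fun ω => Real.mul_self_sqrt (wt_nonneg h0 h1 ω)
  have e1 : ∀ u v : (ι → Bool) → ℝ, Ex p (fun ω => u ω * v ω) =
      ∑ ω, (Real.sqrt (wt p ω) * u ω) * (Real.sqrt (wt p ω) * v ω) := by
    intro u v
    apply Finset.sum_congr rfl; intro ω _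
    calc wt p ω * (u ω * v ω) = (Real.sqrt (wt p ω) * Real.sqrt (wt p ω)) * (u ω * v ω) := by
          rw [hs]
      _ = _ := by ring
  simp only [sq] at this ⊢
  rw [e1, e1, e1]
  exact this

/-- agreement off one coordinate -/
def AgreeOff (e : ι) (ω ω' : ι → Bool) : Prop := ∀ i, i ≠ e → ω i = ω' i

lemma agreeOff_update (e : ι) (ω : ι → Bool) (a b : Bool) :
    AgreeOff e (Function.update ω e a) (Function.update ω e b) := by
  intro i hi; simp [hi]

lemma Ex_centered_zero (p : ℝ) (e : ι) (f : (ι → Bool) → ℝ)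
    (hf : ∀ ω ω', AgreeOff e ω ω' → f ω = f ω') :
    Ex p (fun ω => ((if ω e then 1 else 0) - p) * f ω) = 0 := by
  rw [Ex_centered]
  have : ∀ ω, f (Function.update ω e true) - f (Function.update ω e false) = 0 := fun ω => by
    rw [hf _ _ (agreeOff_update e ω true false), sub_self]
  simp [this, Ex_const]

/-- Fisher information bound for a layered exploration. -/
lemma fisher {p : ℝ} (h0 : 0 < p) (h1 : p < 1) (X : ℕ → ι → (ι → Bool) → Prop)
    (hu : ∀ r k e ω, X r e ω → X k e ω → r = k)
    (h2 : ∀ r k e e' ω ω', k ≤ r → X r e' ω → X k e ω → AgreeOff e' ω ω' → X k e ω')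
    (ψ : (ι → Bool) → ℝ)
    (hψ : ∀ e ω ω', AgreeOff e ω ω' → (¬ ∃ r, X r e ω) → ψ ω = ψ ω') :
    (deriv (fun q => Ex q ψ) p) ^ 2 ≤ Ex p (fun ω => ψ ω ^ 2) *
      Ex p (fun ω => ∑ e, ind (∃ r, X r e ω)) / (p * (1 - p)) := by
  have hp : 0 < p * (1 - p) := mul_pos h0 (by linarith)
  have hag : ∀ e (ω ω' : ι → Bool), AgreeOff e ω ω' → AgreeOff e ω' ω :=
    fun e ω ω' h i hi => (h i hi).symm
  have hE : ∀ e ω ω', AgreeOff e ω ω' → ((∃ r, X r e ω) ↔ ∃ r, X r e ω') := by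
    intro e ω ω' h
    constructor
    · rintro ⟨r, hr⟩; exact ⟨r, h2 r r e e ω ω' le_rfl hr hr h⟩
    · rintro ⟨r, hr⟩; exact ⟨r, h2 r r e e ω' ω le_rfl hr hr (hag _ _ _ h)⟩
  let x : ι → (ι → Bool) → ℝ := fun e ω => (if ω e then 1 else 0) - p
  let S : (ι → Bool) → ℝ := fun ω => ∑ e, x e ω * ind (∃ r, X r e ω)
  have hd : p * (1 - p) * deriv (fun q => Ex q ψ) p = Ex p (fun ω => ψ ω * S ω) := by
    rw [(russo p ψ).deriv, Finset.mul_sum]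
    simp only [S, Finset.mul_sum, Ex_sum]
    apply Finset.sum_congr rfl
    intro e _
    rw [← Ex_centered]
    have hz := Ex_centered_zero p e (fun ω => ψ ω * (1 - ind (∃ r, X r e ω))) (by
      intro ω ω' h
      rw [ind_congr (hE e ω ω' h)]
      by_cases hx : ∃ r, X r e ω'
      · simp [ind_true hx]
      · rw [hψ e ω ω' h (fun hh => hx ((hE e ω ω' h).1 hh))])
    have : (fun ω => ((if ω e then 1 else 0) - p) * ψ ω) = fun ω =>
        ((if ω e then 1 else 0) - p) * (ψ ω * (1 - ind (∃ r, X r e ω))) +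
          ψ ω * (x e ω * ind (∃ r, X r e ω)) := by
      ext ω; simp only [x]; ring
    rw [this, Ex_add, hz, zero_add]
  have hS : Ex p (fun ω => S ω ^ 2) = p * (1 - p) * Ex p (fun ω => ∑ e, ind (∃ r, X r e ω)) := by
    have e1 : (fun ω => S ω ^ 2) = fun ω => ∑ e, ∑ e', (x e ω * ind (∃ r, X r e ω)) *
        (x e' ω * ind (∃ r, X r e' ω)) := by
      ext ω; simp only [S, sq, Finset.sum_mul_sum]
    rw [e1, Ex_sum, Ex_sum, Finset.mul_sum]
    apply Finset.sum_congr rfl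
    intro e _
    rw [Ex_sum, Finset.sum_eq_single e]
    · have : (fun ω => x e ω * ind (∃ r, X r e ω) * (x e ω * ind (∃ r, X r e ω))) =
          fun ω => ((if ω e then 1 else 0) - p) * (((if ω e then 1 else 0) - p) *
            ind (∃ r, X r e ω)) := by
        ext ω; simp only [x, ind]; split_ifs <;> ring
      rw [this, Ex_centered]
      congr 1
      rw [Ex_split p e (fun ω => ind (∃ r, X r e ω))]
      congr 1
      ext ω
      rw [ind_congr (hE e _ _ (agreeOff_update e ω true false))]
      simp only [Function.update_self]; simp; ring
    · intro e' _ hne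
      let P1 : (ι → Bool) → Prop := fun ω => ∃ r k, k ≤ r ∧ X r e' ω ∧ X k e ω
      let P2 : (ι → Bool) → Prop := fun ω => ∃ r k, r < k ∧ X r e' ω ∧ X k e ω
      have hP1 : ∀ ω ω', AgreeOff e' ω ω' → P1 ω → P1 ω' := by
        rintro ω ω' h ⟨r, k, hk, hr, hkk⟩
        exact ⟨r, k, hk, h2 r r e' e' ω ω' le_rfl hr hr h, h2 r k e e' ω ω' hk hr hkk h⟩
      have hP2 : ∀ ω ω', AgreeOff e ω ω' → P2 ω → P2 ω' := by
        rintro ω ω' h ⟨r, k, hk, hr, hkk⟩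
        exact ⟨r, k, hk, h2 k r e' e ω ω' hk.le hkk hr h, h2 k k e e ω ω' le_rfl hkk hkk h⟩
      have hsp : ∀ ω, ind (∃ r, X r e ω) * ind (∃ r, X r e' ω) = ind (P1 ω) + ind (P2 ω) := by
        intro ω
        by_cases ha : ∃ r, X r e ω
        · by_cases hb : ∃ r, X r e' ω
          · obtain ⟨k, hk⟩ := ha
            obtain ⟨r, hr⟩ := hb
            rw [ind_true ⟨k, hk⟩, ind_true ⟨r, hr⟩]
            by_cases hkr : k ≤ r
            · rw [ind_true (show P1 ω from ⟨r, k, hkr, hr, hk⟩), ind_false]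
              · norm_num
              · rintro ⟨r', k', hlt, hr', hk'⟩
                have := hu _ _ _ _ hr hr'
                have := hu _ _ _ _ hk hk'
                omega
            · rw [ind_true (show P2 ω from ⟨r, k, by omega, hr, hk⟩), ind_false]
              · norm_num
              · rintro ⟨r', k', hlt, hr', hk'⟩
                have := hu _ _ _ _ hr hr'
                have := hu _ _ _ _ hk hk'
                omega
          · have n1 : ¬ P1 ω := by rintro ⟨r', k', -, hr', -⟩; exact hb ⟨r', hr'⟩
            have n2 : ¬ P2 ω := by rintro ⟨r', k', -, hr', -⟩; exact hb ⟨r', hr'⟩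
            rw [ind_false hb, ind_false n1, ind_false n2]; norm_num
        · have n1 : ¬ P1 ω := by rintro ⟨r', k', -, -, hr'⟩; exact ha ⟨k', hr'⟩
          have n2 : ¬ P2 ω := by rintro ⟨r', k', -, -, hr'⟩; exact ha ⟨k', hr'⟩
          rw [ind_false ha, ind_false n1, ind_false n2]; norm_num
      have : (fun ω => x e ω * ind (∃ r, X r e ω) * (x e' ω * ind (∃ r, X r e' ω))) =
          fun ω => ((if ω e' then 1 else 0) - p) * (x e ω * ind (P1 ω)) +
            ((if ω e then 1 else 0) - p) * (x e' ω * ind (P2 ω)) := by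
        ext ω
        have := hsp ω
        calc _ = x e ω * x e' ω * (ind (∃ r, X r e ω) * ind (∃ r, X r e' ω)) := by ring
          _ = _ := by rw [this]; simp only [x]; ring
      rw [this, Ex_add, Ex_centered_zero, Ex_centered_zero, add_zero]
      · intro ω ω' h
        have : x e' ω = x e' ω' := by simp only [x, h e' hne]
        rw [this, ind_congr ⟨hP2 ω ω' h, hP2 ω' ω (hag _ _ _ h)⟩]
      · intro ω ω' h
        have : x e ω = x e ω' := by simp only [x, h e (Ne.symm hne)]
        rw [this, ind_congr ⟨hP1 ω ω' h, hP1 ω' ω (hag _ _ _ h)⟩]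
    · intro h; exact absurd (Finset.mem_univ e) h
  have hcs := ex_cs h0.le h1.le ψ S
  rw [← hd, hS] at hcs
  rw [le_div_iff₀ hp]
  have : (p * (1 - p)) * ((deriv (fun q => Ex q ψ) p) ^ 2 * (p * (1 - p))) ≤
      (p * (1 - p)) * (Ex p (fun ω => ψ ω ^ 2) * Ex p (fun ω => ∑ e, ind (∃ r, X r e ω))) := by
    nlinarith [hcs]
  exact le_of_mul_le_mul_left this hp

end Abstract

end PercAux

namespace PercAux

section Abstract2

variable {ι : Type*} [Fintype ι]

/-- update of one coordinate (with classical decidability) -/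
def upd (ω : ι → Bool) (e : ι) (b : Bool) : ι → Bool := Function.update ω e b

lemma upd_self (ω : ι → Bool) (e : ι) (b : Bool) : upd ω e b e = b := by simp [upd]
lemma upd_ne (ω : ι → Bool) {e i : ι} (b : Bool) (h : i ≠ e) : upd ω e b i = ω i := by
  simp [upd, h]
lemma upd_eq (ω : ι → Bool) (e : ι) (b : Bool) (h : ω e = b) : upd ω e b = ω := by
  funext i
  by_cases hi : i = e
  · subst hi; rw [upd_self, h]
  · rw [upd_ne _ _ hi]

/-- coordinatewise order on configurations -/
def Le (ω ω' : ι → Bool) : Prop := ∀ i, ω i = true → ω' i = true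

lemma Le.rfl' (ω : ι → Bool) : Le ω ω := fun _ h => h
lemma Le.trans' {a b c : ι → Bool} (h : Le a b) (h' : Le b c) : Le a c := fun i hi => h' i (h i hi)
lemma le_upd (ω : ι → Bool) (e : ι) : Le ω (upd ω e true) := by
  intro i hi
  by_cases h : i = e
  · subst h; rw [upd_self]
  · rw [upd_ne _ _ h, hi]
lemma Le_of_le {ω ω' : ι → Bool} (h : ω ≤ ω') : Le ω ω' := by
  intro i hi
  have := h i
  rw [hi] at this
  revert this
  cases ω' i <;> simp

/-- increasing event -/
def Inc (A : (ι → Bool) → Prop) : Prop := ∀ ω ω', Le ω ω' → A ω → A ω'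

/-- probability of an event -/
def Pr (p : ℝ) (A : (ι → Bool) → Prop) : ℝ := Ex p (fun ω => ind (A ω))

lemma Pr_mono {p : ℝ} (h0 : 0 ≤ p) (h1 : p ≤ 1) {A B : (ι → Bool) → Prop}
    (h : ∀ ω, A ω → B ω) : Pr p A ≤ Pr p B := Ex_mono h0 h1 fun ω => ind_mono (h ω)
lemma Pr_nonneg {p : ℝ} (h0 : 0 ≤ p) (h1 : p ≤ 1) (A : (ι → Bool) → Prop) : 0 ≤ Pr p A :=
  Ex_nonneg h0 h1 fun _ => ind_nonneg _
lemma Pr_le_one {p : ℝ} (h0 : 0 ≤ p) (h1 : p ≤ 1) (A : (ι → Bool) → Prop) : Pr p A ≤ 1 := by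
  calc Pr p A ≤ Ex p (fun _ => 1) := Ex_mono h0 h1 fun _ => ind_le_one _
    _ = 1 := Ex_one p
lemma Pr_congr {p : ℝ} {A B : (ι → Bool) → Prop} (h : ∀ ω, A ω ↔ B ω) : Pr p A = Pr p B := by
  unfold Pr; congr 1; ext ω; exact ind_congr (h ω)
lemma Pr_true (p : ℝ) {A : (ι → Bool) → Prop} (h : ∀ ω, A ω) : Pr p A = 1 := by
  unfold Pr
  rw [← Ex_one (ι := ι) p]; congr 1; ext ω; exact ind_true (h ω)

lemma Pr_exists {α : Type*} {p : ℝ} (h0 : 0 ≤ p) (h1 : p ≤ 1) (s : Finset α)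
    (A : α → (ι → Bool) → Prop) :
    Pr p (fun ω => ∃ a ∈ s, A a ω) ≤ ∑ a ∈ s, Pr p (A a) := by
  unfold Pr
  rw [← Ex_sum]
  apply Ex_mono h0 h1
  intro ω
  by_cases h : ∃ a ∈ s, A a ω
  · obtain ⟨a, ha, hA⟩ := h
    rw [ind_true ⟨a, ha, hA⟩, ← ind_true hA]
    exact Finset.single_le_sum (f := fun a => ind (A a ω)) (fun i _ => ind_nonneg _) ha
  · rw [ind_false h]
    exact Finset.sum_nonneg fun i _ => ind_nonneg _

lemma Pr_or {p : ℝ} (h0 : 0 ≤ p) (h1 : p ≤ 1) (A B : (ι → Bool) → Prop) :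
    Pr p (fun ω => A ω ∨ B ω) ≤ Pr p A + Pr p B := by
  unfold Pr
  rw [← Ex_add]
  apply Ex_mono h0 h1
  intro ω
  by_cases hA : A ω
  · rw [ind_true (Or.inl hA), ind_true hA]; linarith [ind_nonneg (B ω)]
  · by_cases hB : B ω
    · rw [ind_true (Or.inr hB), ind_true hB]; linarith [ind_nonneg (A ω)]
    · rw [ind_false (by tauto), ind_false hA, ind_false hB]; norm_num

lemma Pr_mono_p {A : (ι → Bool) → Prop} (hA : Inc A) {p q : ℝ} (h0 : 0 ≤ p) (h : p ≤ q)
    (h1 : q ≤ 1) : Pr p A ≤ Pr q A :=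
  Ex_mono_p (fun _ _ h => ind_mono (hA _ _ (Le_of_le h))) h0 h h1

lemma Pr_open (p : ℝ) (e : ι) : Pr p (fun ω : ι → Bool => ω e = true) = p := by
  have := Ex_open p e (fun _ => 1)
  rw [Ex_one] at this
  calc _ = _ := ?_
    _ = _ := this
    _ = p := mul_one p
  unfold Pr ind
  congr 1; ext ω
  by_cases h : ω e = true <;> simp [h]

lemma BK' {p : ℝ} (h0 : 0 ≤ p) (h1 : p ≤ 1) {A B : (ι → Bool) → Prop}
    (hA : Inc A) (hB : Inc B) : Pr p (Disj A B) ≤ Pr p A * Pr p B :=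
  BK h0 h1 A B hA hB

lemma Disj_inc (A B : (ι → Bool) → Prop) : Inc (Disj A B) := by
  rintro ω ω' h ⟨s, t, hs, ht, hd, hA, hB⟩
  exact ⟨s, t, Le.trans' hs h, Le.trans' ht h, hd, hA, hB⟩

lemma BK3 {p : ℝ} (h0 : 0 ≤ p) (h1 : p ≤ 1) {A B C : (ι → Bool) → Prop}
    (hA : Inc A) (hB : Inc B) (hC : Inc C) :
    Pr p (Disj A (Disj B C)) ≤ Pr p A * (Pr p B * Pr p C) :=
  (BK' h0 h1 hA (Disj_inc B C)).trans
    (mul_le_mul_of_nonneg_left (BK' h0 h1 hB hC) (Pr_nonneg h0 h1 A))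

lemma closed_deriv (q : ℝ) (f : (ι → Bool) → ℝ) :
    ∑ e, Ex q (fun ω => if ω e then 0 else f (upd ω e true) - f ω) =
      (1 - q) * deriv (fun q => Ex q f) q := by
  rw [(russo q f).deriv, Finset.mul_sum]
  apply Finset.sum_congr rfl
  intro e _
  rw [← Ex_mul_left, Ex_split q e]
  congr 1
  ext ω
  simp [upd]

lemma Ex_equiv (p : ℝ) (σ : ι ≃ ι) (f : (ι → Bool) → ℝ) :
    Ex p (fun ω => f (fun e => ω (σ e))) = Ex p f := by
  unfold Ex
  have h1 : ∀ ω : ι → Bool, (fun e => (fun e => ω (σ e)) (σ.symm e)) = ω := fun ω => by simp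
  have h2 : ∀ ω : ι → Bool, (fun e => (fun e => ω (σ.symm e)) (σ e)) = ω := fun ω => by simp
  let τ : (ι → Bool) ≃ (ι → Bool) :=
    ⟨fun ω e => ω (σ e), fun ω e => ω (σ.symm e), h1, h2⟩
  rw [← Equiv.sum_comp τ (fun ω => wt p ω * f ω)]
  apply Finset.sum_congr rfl
  intro ω _
  congr 1
  unfold wt
  exact (Equiv.prod_comp σ (fun e => if ω e then p else 1 - p)).symm

lemma differentiable_Ex (f : (ι → Bool) → ℝ) : Differentiable ℝ (fun q => Ex q f) :=
  fun q => (russo q f).differentiableAt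

end Abstract2

section Perc

variable {V : Type} [Fintype V] [DecidableEq V] {G : SimpleGraph V}

/-- configurations as plain functions -/
abbrev Cf (G : SimpleGraph V) := G.edgeSet → Bool

/-- the edge of an adjacency -/
def ed {x y : V} (h : G.Adj x y) : G.edgeSet := ⟨s(x, y), (SimpleGraph.mem_edgeSet G).2 h⟩

lemma ed_symm {x y : V} (h : G.Adj x y) (h' : G.Adj y x) : ed h = ed h' :=
  Subtype.ext Sym2.eq_swap

/-- connection event -/
def R (ω : Cf G) (x y : V) : Prop := (Percolation.occupied G ω).Reachable x y

lemma occ_adj (ω : Cf G) (x y : V) : (Percolation.occupied G ω).Adj x y ↔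
    ∃ h : G.Adj x y, ω (ed h) = true := by
  unfold Percolation.occupied
  rw [SimpleGraph.fromEdgeSet_adj]
  constructor
  · rintro ⟨⟨h, h'⟩, -⟩
    exact ⟨h, h'⟩
  · rintro ⟨h, h'⟩
    exact ⟨⟨h, h'⟩, h.ne⟩

lemma R_iff (ω : Cf G) (x y : V) : R ω x y ↔
    Relation.ReflTransGen (fun x y => ∃ h : G.Adj x y, ω (ed h) = true) x y := by
  unfold R
  rw [SimpleGraph.reachable_iff_reflTransGen]
  have : (Percolation.occupied G ω).Adj =
    (fun x y => ∃ h : G.Adj x y, ω (ed h) = true) := by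
    ext x y; exact occ_adj ω x y
  rw [this]

lemma R_refl (ω : Cf G) (x : V) : R ω x x := SimpleGraph.Reachable.refl x
lemma R_symm {ω : Cf G} {x y : V} (h : R ω x y) : R ω y x := SimpleGraph.Reachable.symm h
lemma R_trans {ω : Cf G} {x y z : V} (h : R ω x y) (h' : R ω y z) : R ω x z :=
  SimpleGraph.Reachable.trans h h'
lemma R_edge {ω : Cf G} {x y : V} (h : G.Adj x y) (h' : ω (ed h) = true) : R ω x y :=
  SimpleGraph.Adj.reachable ((occ_adj ω x y).2 ⟨h, h'⟩)

/-- induction on reachability -/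
lemma R_ind {ω : Cf G} {x : V} {P : V → Prop} (h0 : P x)
    (hs : ∀ y z, R ω x y → P y → ∀ h : G.Adj y z, ω (ed h) = true → P z) :
    ∀ y, R ω x y → P y := by
  intro y hy
  have h2 := (R_iff ω x y).1 hy
  clear hy
  induction h2 with
  | refl => exact h0
  | tail hab hbc ih =>
    obtain ⟨h, h'⟩ := hbc
    exact hs _ _ ((R_iff ω x _).2 hab) ih h h'

lemma R_mono {ω ω' : Cf G} (h : Le ω ω') {x y : V} (hR : R ω x y) : R ω' x y := by
  apply R_ind (P := fun y => R ω' x y) (R_refl _ _) _ y hR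
  intro y z _ hy ha ho
  exact R_trans hy (R_edge ha (h _ ho))

lemma R_inc (x y : V) : Inc (fun ω : Cf G => R ω x y) := fun _ _ h hR => R_mono h hR

/-- the edge touches the vertex set -/
def touch (T : Finset V) (e : G.edgeSet) : Prop := ∃ v ∈ T, v ∈ e.1

/-- close all edges touching `T` -/
def off (T : Finset V) (ω : Cf G) : Cf G := fun e => ω e && decide (¬ touch T e)

lemma off_true {T : Finset V} {ω : Cf G} {e : G.edgeSet} :
    off T ω e = true ↔ ω e = true ∧ ¬ touch T e := by simp [off]

lemma touch_mk {T : Finset V} {x y : V} (h : G.Adj x y) :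
    touch T (ed h) ↔ x ∈ T ∨ y ∈ T := by
  unfold touch
  constructor
  · rintro ⟨v, hv, hm⟩
    rcases Sym2.mem_iff.1 hm with h | h
    · left; rwa [← h]
    · right; rwa [← h]
  · rintro (h | h)
    · exact ⟨x, h, Sym2.mem_mk_left _ _⟩
    · exact ⟨y, h, Sym2.mem_mk_right _ _⟩

lemma off_le (T : Finset V) (ω : Cf G) : Le (off T ω) ω := fun _ h => (off_true.1 h).1

lemma off_mono (T : Finset V) {ω ω' : Cf G} (h : Le ω ω') : Le (off T ω) (off T ω') := by
  intro i hi
  rw [off_true] at hi ⊢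
  exact ⟨h i hi.1, hi.2⟩

lemma off_inc (T : Finset V) (x y : V) : Inc (fun ω : Cf G => R (off T ω) x y) :=
  fun _ _ h hR => R_mono (off_mono T h) hR

lemma off_notMem {T : Finset V} {ω : Cf G} {x y : V} (hx : x ∉ T) (h : R (off T ω) x y) : y ∉ T := by
  apply R_ind (P := fun y => y ∉ T) hx _ y h
  intro y z _ _ ha ho
  rw [off_true, touch_mk] at ho
  tauto

/-- cluster of a set -/
def Cg (ω : Cf G) (g : Finset V) : Finset V := Finset.univ.filter fun z => ∃ a ∈ g, R ω a z

lemma mem_Cg {ω : Cf G} {g : Finset V} {z : V} : z ∈ Cg ω g ↔ ∃ a ∈ g, R ω a z := by simp [Cg]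

/-- cluster of a vertex -/
def Cl (ω : Cf G) (x : V) : Finset V := Percolation.cluster G ω x

lemma mem_Cl {ω : Cf G} {x y : V} : y ∈ Cl ω x ↔ R ω x y := by
  simp [Cl, Percolation.cluster, R]

lemma Cg_single (ω : Cf G) (x : V) : Cg ω {x} = Cl ω x := by
  ext z; simp [mem_Cg, mem_Cl]

lemma Cg_step {ω : Cf G} {g : Finset V} {x y : V} (hx : x ∈ Cg ω g) (h : R ω x y) : y ∈ Cg ω g := by
  rw [mem_Cg] at hx ⊢
  obtain ⟨a, ha, hR⟩ := hx
  exact ⟨a, ha, R_trans hR h⟩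

lemma K1 {ω ω' : Cf G} {g T : Finset V} (hag : ∀ e : G.edgeSet, touch T e → ω e = ω' e)
    (h : Cg ω g = T) : Cg ω' g = T := by
  ext z
  constructor
  · intro hz
    obtain ⟨a, ha, hR⟩ := mem_Cg.1 hz
    apply R_ind (P := fun z => z ∈ T) _ _ z hR
    · rw [← h, mem_Cg]; exact ⟨a, ha, R_refl _ _⟩
    · intro y w _ hy hadj ho
      rw [← hag _ ((touch_mk _).2 (Or.inl hy))] at ho
      rw [← h] at hy ⊢
      exact Cg_step hy (R_edge hadj ho)
  · intro hz
    rw [← h] at hz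
    obtain ⟨a, ha, hR⟩ := mem_Cg.1 hz
    rw [mem_Cg]
    refine ⟨a, ha, ?_⟩
    apply R_ind (P := fun z => R ω' a z) (R_refl _ _) _ z hR
    intro y w hay hy hadj ho
    refine R_trans hy (R_edge hadj ?_)
    rw [← hag]
    · exact ho
    · rw [touch_mk]; left; rw [← h]; exact mem_Cg.2 ⟨a, ha, hay⟩

lemma K2 {ω : Cf G} {g : Finset V} {x y : V} (hx : x ∉ Cg ω g) :
    R ω x y ↔ R (off (Cg ω g) ω) x y := by
  constructor
  · intro h
    apply R_ind (P := fun y => R (off (Cg ω g) ω) x y) (R_refl _ _) _ y h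
    intro y z hxy hy hadj ho
    refine R_trans hy (R_edge hadj ?_)
    rw [off_true, touch_mk]
    refine ⟨ho, ?_⟩
    rintro (h | h)
    · exact hx (Cg_step h (R_symm hxy))
    · exact hx (Cg_step h (R_symm (R_trans hxy (R_edge hadj ho))))
  · exact R_mono (off_le _ _)

lemma K2' {ω : Cf G} {g : Finset V} {x : V} (hx : x ∉ Cg ω g) :
    Cl ω x = Cl (off (Cg ω g) ω) x := by
  ext y; rw [mem_Cl, mem_Cl, K2 hx]

/-- Factorisation by exploring the cluster of `g`. -/
lemma FAC (p : ℝ) (g : Finset V) (H : Finset V → Cf G → ℝ) :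
    Ex p (fun ω : Cf G => H (Cg ω g) (off (Cg ω g) ω)) =
      Ex p (fun ω : Cf G => Ex p (fun ω' : Cf G => H (Cg ω g) (off (Cg ω g) ω'))) := by
  have hs : ∀ (F : Finset V → ℝ) (T0 : Finset V), F T0 = ∑ T, ind (T0 = T) * F T := by
    intro F T0
    rw [Finset.sum_eq_single T0]
    · rw [ind_true rfl, one_mul]
    · intro b _ hb; rw [ind_false (Ne.symm hb), zero_mul]
    · intro h; exact absurd (Finset.mem_univ _) h
  have e1 : (fun ω : Cf G => H (Cg ω g) (off (Cg ω g) ω)) =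
      fun ω : Cf G => ∑ T, ind (Cg ω g = T) * H T (off T ω) := by
    ext ω; exact hs (fun T => H T (off T ω)) _
  have e2 : (fun ω : Cf G => Ex p (fun ω' => H (Cg ω g) (off (Cg ω g) ω'))) =
      fun ω : Cf G => ∑ T, ind (Cg ω g = T) * Ex p (fun ω' : Cf G => H T (off T ω')) := by
    ext ω; exact hs (fun T => Ex p (fun ω' : Cf G => H T (off T ω'))) _
  rw [e1, e2, Ex_sum, Ex_sum]
  apply Finset.sum_congr rfl
  intro T _
  rw [Ex_mul_right]
  apply Ex_indep p (touch T)
  · intro ω ω' h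
    exact ind_congr ⟨K1 h, K1 fun e he => (h e he).symm⟩
  · intro ω ω' h
    congr 1
    ext e
    unfold off
    by_cases he : touch T e
    · simp [he]
    · rw [h e he]

/-! ### Bridge -/

lemma fin_univ_eq {α : Type*} (a b : Fintype α) : @Finset.univ α a = @Finset.univ α b := by
  rw [Subsingleton.elim a b]

lemma bridge_Ex (p : ℝ) (f : Cf G → ℝ) : Percolation.expect G p f = Ex p f := by
  unfold Percolation.expect Ex
  apply Finset.sum_congr
  · exact fin_univ_eq _ _
  · intro ω _; rfl

lemma bridge_Pr (p : ℝ) (A : Cf G → Prop) : Percolation.prob G p A = Pr p A := by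
  unfold Percolation.prob Pr Ex
  apply Finset.sum_congr
  · exact fin_univ_eq _ _
  · intro ω _
    unfold ind
    by_cases h : A ω
    · simp only [h, if_true, mul_one]; rfl
    · simp only [h, if_false, mul_zero]

/-- two-point function -/
def t (G : SimpleGraph V) (p : ℝ) (x y : V) : ℝ := Pr p (fun ω : Cf G => R ω x y)

lemma bridge_tau (p : ℝ) (x y : V) : Percolation.tau G p x y = t G p x y := bridge_Pr p _

lemma t_symm (p : ℝ) (x y : V) : t G p x y = t G p y x := Pr_congr fun _ => ⟨R_symm, R_symm⟩
lemma t_self (p : ℝ) (x : V) : t G p x x = 1 := Pr_true p fun ω => R_refl ω x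
lemma t_nonneg {p : ℝ} (h0 : 0 ≤ p) (h1 : p ≤ 1) (x y : V) : 0 ≤ t G p x y := Pr_nonneg h0 h1 _
lemma t_mono {p q : ℝ} (h0 : 0 ≤ p) (h : p ≤ q) (h1 : q ≤ 1) (x y : V) : t G p x y ≤ t G q x y :=
  Pr_mono_p (R_inc x y) h0 h h1

/-- susceptibility -/
def X (G : SimpleGraph V) (p : ℝ) (x : V) : ℝ := Ex p (fun ω : Cf G => ((Cl ω x).card : ℝ))

lemma card_Cl (ω : Cf G) (x : V) : ((Cl ω x).card : ℝ) = ∑ y, ind (R ω x y) := by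
  unfold ind
  rw [Finset.sum_boole]
  congr 2
  ext y; simp [mem_Cl]

lemma X_eq (p : ℝ) (x : V) : X G p x = ∑ y, t G p x y := by
  unfold X t Pr
  simp only [card_Cl, Ex_sum]

/-! ### Automorphisms -/

/-- pull back a configuration -/
def pull (φ : G ≃g G) (ω : Cf G) : Cf G := fun e => ω (φ.mapEdgeSet e)

lemma pull_R' (φ : G ≃g G) (ω : Cf G) {x y : V} (h : R (pull φ ω) x y) : R ω (φ x) (φ y) := by
  apply R_ind (P := fun y => R ω (φ x) (φ y)) (R_refl _ _) _ y h
  intro y z _ hy hadj ho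
  exact R_trans hy (R_edge (φ.map_adj_iff.2 hadj) ho)

lemma pull_pull (φ : G ≃g G) (ω : Cf G) : pull φ.symm (pull φ ω) = ω := by
  ext e
  unfold pull
  congr 1
  exact φ.mapEdgeSet.apply_symm_apply e

lemma pull_R (φ : G ≃g G) (ω : Cf G) (x y : V) : R (pull φ ω) x y ↔ R ω (φ x) (φ y) := by
  constructor
  · exact pull_R' φ ω
  · intro h
    rw [← pull_pull φ ω] at h
    have := pull_R' _ _ h
    simpa using this

lemma Ex_pull (p : ℝ) (φ : G ≃g G) (f : Cf G → ℝ) : Ex p (fun ω => f (pull φ ω)) = Ex p f := by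
  exact Ex_equiv p φ.mapEdgeSet f

lemma t_aut (p : ℝ) (φ : G ≃g G) (x y : V) : t G p (φ x) (φ y) = t G p x y := by
  unfold t Pr
  rw [← Ex_pull p φ (fun ω => ind (R ω x y))]
  congr 1
  ext ω
  exact ind_congr (pull_R φ ω x y).symm

lemma card_aut (φ : G ≃g G) (ω : Cf G) (x : V) : (Cl (pull φ ω) x).card = (Cl ω (φ x)).card := by
  apply Finset.card_bij (fun a _ => φ a)
  · intro a ha; rw [mem_Cl] at ha ⊢; exact (pull_R φ ω x a).1 ha
  · intro a _ b _ h; exact φ.injective h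
  · intro b hb
    refine ⟨φ.symm b, ?_, by simp⟩
    rw [mem_Cl] at hb ⊢
    rw [pull_R]; simpa using hb

lemma Ex_card_aut (p : ℝ) (hT : Percolation.IsTransitive G) (ψ : ℕ → ℝ) (x y : V) :
    Ex p (fun ω : Cf G => ψ (Cl ω x).card) = Ex p (fun ω : Cf G => ψ (Cl ω y).card) := by
  obtain ⟨φ, rfl⟩ := hT x y
  rw [← Ex_pull p φ]
  simp only [card_aut]

lemma X_const (p : ℝ) (hT : Percolation.IsTransitive G) (x y : V) : X G p x = X G p y :=
  Ex_card_aut p hT (fun n => (n : ℝ)) x y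

end Perc

end PercAux

namespace PercAux

section Walks

variable {V : Type} [Fintype V] [DecidableEq V] {G : SimpleGraph V}

/-- the configuration with exactly the edges of a list open -/
def conf (G : SimpleGraph V) (l : List (Sym2 V)) : Cf G := fun e => decide (e.1 ∈ l)

lemma conf_true {l : List (Sym2 V)} {e : G.edgeSet} : conf G l e = true ↔ e.1 ∈ l := by simp [conf]

lemma conf_mono {l l' : List (Sym2 V)} (h : ∀ e ∈ l, e ∈ l') : Le (conf G l) (conf G l') := by
  intro e he
  rw [conf_true] at he ⊢
  exact h _ he

lemma walk_R {ω : Cf G} {a b : V} (w : (Percolation.occupied G ω).Walk a b) :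
    R (conf G w.edges) a b := by
  induction w with
  | nil => exact R_refl _ _
  | cons h p ih =>
    obtain ⟨hG, -⟩ := (occ_adj ω _ _).1 h
    refine R_trans (R_edge hG ?_) (R_mono (conf_mono ?_) ih)
    · rw [conf_true]; simp [ed]
    · intro e he; simp [he]

lemma walk_le {ω : Cf G} {a b : V} (w : (Percolation.occupied G ω).Walk a b) :
    Le (conf G w.edges) ω := by
  intro e he
  rw [conf_true] at he
  have := SimpleGraph.Walk.edges_subset_edgeSet w he
  obtain ⟨e, hE⟩ := e
  induction e using Sym2.ind with
  | _ x y =>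
    have h2 := (occ_adj ω x y).1 this
    obtain ⟨h, h'⟩ := h2
    exact h'

lemma Disj_lists {A B : Cf G → Prop} {ω : Cf G} {l l1 l2 : List (Sym2 V)}
    (hl : Le (conf G l) ω) (h1 : ∀ e ∈ l1, e ∈ l) (h2 : ∀ e ∈ l2, e ∈ l)
    (hd : ∀ e ∈ l1, e ∉ l2) (hA : A (conf G l1)) (hB : B (conf G l2)) : Disj A B ω := by
  refine ⟨conf G l1, conf G l2, (conf_mono h1).trans' hl, (conf_mono h2).trans' hl, ?_, hA, hB⟩
  rintro e ⟨ha, hb⟩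
  exact hd _ (conf_true.1 ha) (conf_true.1 hb)

lemma exists_path {ω : Cf G} {a b : V} (h : R ω a b) :
    ∃ w : (Percolation.occupied G ω).Walk a b, w.IsPath := by
  obtain ⟨w⟩ := h
  exact ⟨w.bypass, w.bypass_isPath⟩

lemma walk_off {ω : Cf G} {A : Finset V} {a b : V} (w : (Percolation.occupied G ω).Walk a b)
    (h : ∀ x ∈ w.support, x ∉ A) : R (off A ω) a b := by
  induction w with
  | nil => exact R_refl _ _
  | cons hadj p ih =>
    obtain ⟨hG, ho⟩ := (occ_adj ω _ _).1 hadj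
    refine R_trans (R_edge hG ?_) (ih ?_)
    · rw [off_true, touch_mk]
      refine ⟨ho, ?_⟩
      rintro (h' | h')
      · exact h _ (by simp) h'
      · exact h _ (by simp) h'
    · intro x hx; exact h x (by simp [hx])

lemma split_disj {ω : Cf G} {a b c : V} (w : (Percolation.occupied G ω).Walk a b) (hw : w.IsPath)
    (hc : c ∈ w.support) :
    ∃ l1 l2 : List (Sym2 V), (∀ e ∈ l1, e ∈ w.edges) ∧ (∀ e ∈ l2, e ∈ w.edges) ∧
      (∀ e ∈ l1, e ∉ l2) ∧ R (conf G l1) a c ∧ R (conf G l2) c b := by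
  refine ⟨(w.takeUntil c hc).edges, (w.dropUntil c hc).edges,
    fun e he => w.edges_takeUntil_subset_edges hc he, fun e he => w.edges_dropUntil_subset_edges hc he, ?_,
    walk_R _, walk_R _⟩
  have h1 : w.edges.Nodup := hw.isTrail.edges_nodup
  rw [← w.take_spec hc, SimpleGraph.Walk.edges_append] at h1
  intro e he he'
  exact (List.disjoint_of_nodup_append h1) he he'

lemma T1_det {ω : Cf G} {A : Finset V} {v y : V} (h : R ω v y) (h' : ¬ R (off A ω) v y) :
    ∃ w ∈ A, Disj (fun ω => R ω v w) (fun ω => R ω w y) ω := by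
  obtain ⟨w, hw⟩ := exists_path h
  have : ∃ x ∈ w.support, x ∈ A := by
    by_contra hcon
    push Not at hcon
    exact h' (walk_off w hcon)
  obtain ⟨x, hx, hA⟩ := this
  obtain ⟨l1, l2, a1, a2, a3, a4, a5⟩ := split_disj w hw hx
  exact ⟨x, hA, Disj_lists (walk_le w) a1 a2 a3 a4 a5⟩

lemma T1 {p : ℝ} (h0 : 0 ≤ p) (h1 : p ≤ 1) (A : Finset V) (v y : V) :
    t G p v y ≤ Pr p (fun ω : Cf G => R (off A ω) v y) + ∑ w ∈ A, t G p v w * t G p w y := by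
  calc t G p v y ≤ Pr p (fun ω : Cf G => R (off A ω) v y ∨
        ∃ w ∈ A, Disj (fun ω => R ω v w) (fun ω => R ω w y) ω) := by
        apply Pr_mono h0 h1
        intro ω h
        by_cases h' : R (off A ω) v y
        · exact Or.inl h'
        · exact Or.inr (T1_det h h')
    _ ≤ _ := Pr_or h0 h1 _ _
    _ ≤ _ := by
        gcongr
        refine (Pr_exists h0 h1 _ _).trans ?_
        apply Finset.sum_le_sum
        intro w _
        exact BK' h0 h1 (R_inc v w) (R_inc w y)

lemma first_hit {H : SimpleGraph V} {a b : V} (w : H.Walk a b) (T : List V) (hb : b ∈ T) :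
    ∃ z ∈ T, ∃ w' : H.Walk a z, (∀ e ∈ w'.edges, e ∈ w.edges) ∧
      ∀ e ∈ w'.edges, ∃ x ∈ e, x ∉ T := by
  induction w with
  | nil => exact ⟨_, hb, SimpleGraph.Walk.nil, by simp, by simp⟩
  | @cons u v _ hadj p ih =>
    by_cases hu : u ∈ T
    · exact ⟨u, hu, SimpleGraph.Walk.nil, by simp, by simp⟩
    · obtain ⟨z, hz, w', h1, h2⟩ := ih hb
      refine ⟨z, hz, SimpleGraph.Walk.cons hadj w', ?_, ?_⟩
      · intro e he
        rw [SimpleGraph.Walk.edges_cons, List.mem_cons] at he ⊢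
        rcases he with he | he
        · exact Or.inl he
        · exact Or.inr (h1 e he)
      · intro e he
        rw [SimpleGraph.Walk.edges_cons, List.mem_cons] at he
        rcases he with he | he
        · exact ⟨u, by rw [he]; exact Sym2.mem_mk_left _ _, hu⟩
        · exact h2 e he

lemma T2_det {ω : Cf G} {o u w : V} (hu : R ω o u) (hw : R ω o w) :
    ∃ z ∈ (Finset.univ : Finset V), Disj (fun ω => R ω o z)
      (Disj (fun ω => R ω z u) (fun ω => R ω z w)) ω := by
  obtain ⟨P, hP⟩ := exists_path hu
  obtain ⟨Q, -⟩ := exists_path (R_symm hw)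
  obtain ⟨z, hz, Q', -, hQ'⟩ := first_hit Q P.support P.start_mem_support
  obtain ⟨l1, l2, a1, a2, a3, a4, a5⟩ := split_disj P hP hz
  have hPQ : ∀ e ∈ P.edges, e ∉ Q'.edges := by
    intro e he heQ
    obtain ⟨x, hx, hxP⟩ := hQ' e heQ
    exact hxP (P.mem_support_of_mem_edges he hx)
  refine ⟨z, Finset.mem_univ _, conf G l1, conf G (l2 ++ Q'.edges),
    (conf_mono a1).trans' (walk_le P), ?_, ?_, a4, ?_⟩
  · intro e he
    rw [conf_true, List.mem_append] at he
    rcases he with he | he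
    · exact walk_le P e (conf_true.2 (a2 _ he))
    · exact walk_le Q' e (conf_true.2 he)
  · rintro e ⟨he1, he2⟩
    rw [conf_true] at he1
    rw [conf_true, List.mem_append] at he2
    rcases he2 with he | he
    · exact a3 _ he1 he
    · exact hPQ _ (a1 _ he1) he
  · apply Disj_lists (Le.rfl' _) (l1 := l2) (l2 := Q'.edges)
    · intro e he; simp [he]
    · intro e he; simp [he]
    · intro e he; exact hPQ _ (a2 _ he)
    · exact a5
    · exact R_symm (walk_R Q')

lemma T2 {p : ℝ} (h0 : 0 ≤ p) (h1 : p ≤ 1) (o u w : V) :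
    Pr p (fun ω : Cf G => R ω o u ∧ R ω o w) ≤
      ∑ z, t G p o z * (t G p z u * t G p z w) := by
  refine (Pr_mono h0 h1 (fun ω h => T2_det h.1 h.2)).trans ?_
  refine (Pr_exists h0 h1 _ _).trans ?_
  apply Finset.sum_le_sum
  intro z _
  exact BK3 h0 h1 (R_inc _ _) (R_inc _ _) (R_inc _ _)

/-! ### the exit decomposition -/

lemma exit_walk {ω : Cf G} {T : Finset V} {a z : V} (w : (Percolation.occupied G ω).Walk a z)
    (ha : a ∉ T) : R (off T (conf G w.edges)) a z ∨
    ∃ x y l1 l2, w.edges = l1 ++ s(x, y) :: l2 ∧ G.Adj x y ∧ x ∉ T ∧ y ∈ T ∧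
      R (off T (conf G l1)) a x ∧ R (conf G l2) y z := by
  induction w with
  | nil => exact Or.inl (R_refl _ _)
  | @cons a b z hadj p ih =>
    obtain ⟨hG, ho⟩ := (occ_adj ω _ _).1 hadj
    by_cases hb : b ∈ T
    · right
      exact ⟨a, b, [], p.edges, by simp, hG, ha, hb, R_refl _ _, walk_R p⟩
    · have hstep : ∀ l : List (Sym2 V), R (off T (conf G (s(a, b) :: l))) a b := by
        intro l
        apply R_edge hG
        rw [off_true, touch_mk, conf_true]
        refine ⟨by simp [ed], by tauto⟩
      rcases ih hb with h | ⟨x, y, l1, l2, h1, h2, h3, h4, h5, h6⟩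
      · left
        rw [SimpleGraph.Walk.edges_cons]
        refine R_trans (hstep _) (R_mono (off_mono T (conf_mono ?_)) h)
        intro e he; simp [he]
      · right
        refine ⟨x, y, s(a, b) :: l1, l2, by simp [h1], h2, h3, h4, ?_, h6⟩
        refine R_trans (hstep _) (R_mono (off_mono T (conf_mono ?_)) h5)
        intro e he; simp [he]

lemma exit_det {ω : Cf G} {T : Finset V} {a z : V} (ha : a ∉ T) (h : R ω a z) :
    R (off T ω) a z ∨ ∃ xy ∈ (Finset.univ : Finset (V × V)),
      (G.Adj xy.1 xy.2 ∧ xy.1 ∉ T ∧ xy.2 ∈ T) ∧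
      Disj (fun ω => R (off T ω) a xy.1)
        (Disj (fun ω => ∃ h : G.Adj xy.1 xy.2, ω (ed h) = true) (fun ω => R ω xy.2 z)) ω := by
  obtain ⟨w, hw⟩ := exists_path h
  rcases exit_walk w ha with h | ⟨x, y, l1, l2, h1, h2, h3, h4, h5, h6⟩
  · exact Or.inl (R_mono (off_mono T (walk_le w)) h)
  · right
    refine ⟨(x, y), Finset.mem_univ _, ⟨h2, h3, h4⟩, ?_⟩
    have hnd : w.edges.Nodup := hw.isTrail.edges_nodup
    rw [h1] at hnd
    have hdis := List.disjoint_of_nodup_append hnd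
    have hnd2 := (List.nodup_append.1 hnd).2.1
    apply Disj_lists (walk_le w) (l1 := l1) (l2 := s(x, y) :: l2)
    · intro e he; simp [h1, he]
    · intro e he
      rw [h1]; exact List.mem_append_right _ he
    · intro e he he'; exact hdis he he'
    · exact h5
    · apply Disj_lists (Le.rfl' _) (l1 := [s(x, y)]) (l2 := l2)
      · intro e he; simp at he; simp [he]
      · intro e he; simp [he]
      · intro e he; simp at he; rw [he]; exact (List.nodup_cons.1 hnd2).1
      · exact ⟨h2, by rw [conf_true]; simp [ed]⟩
      · exact h6

lemma DT_point {p : ℝ} (h0 : 0 ≤ p) (h1 : p ≤ 1) (T : Finset V) {a : V} (ha : a ∉ T) (z : V) :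
    t G p a z ≤ Pr p (fun ω : Cf G => R (off T ω) a z) +
      ∑ x, ∑ y, ind (G.Adj x y ∧ x ∉ T ∧ y ∈ T) *
        (Pr p (fun ω : Cf G => R (off T ω) a x) * (p * t G p y z)) := by
  refine (Pr_mono h0 h1 (fun ω h => exit_det ha h)).trans ?_
  refine (Pr_or h0 h1 _ _).trans ?_
  gcongr
  refine (Pr_exists h0 h1 _ _).trans ?_
  rw [Fintype.sum_prod_type]
  apply Finset.sum_le_sum; intro x _
  apply Finset.sum_le_sum; intro y _
  by_cases h : G.Adj x y ∧ x ∉ T ∧ y ∈ T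
  · rw [ind_true h, one_mul]
    refine (Pr_mono h0 h1 (fun ω h => h.2)).trans ?_
    refine (BK3 h0 h1 (off_inc _ _ _) ?_ (R_inc _ _)).trans ?_
    · rintro ω ω' hle ⟨hh, hh'⟩
      exact ⟨hh, hle _ hh'⟩
    · have : Pr p (fun ω : Cf G => ∃ h : G.Adj x y, ω (ed h) = true) = p := by
        refine Eq.trans ?_ (Pr_open p (ed h.1))
        apply Pr_congr
        intro ω
        exact ⟨fun ⟨_, h⟩ => h, fun hh => ⟨h.1, hh⟩⟩
      rw [this]
      exact le_rfl
  · rw [ind_false h, zero_mul]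
    unfold Pr
    have : ∀ ω : Cf G, ind ((G.Adj x y ∧ x ∉ T ∧ y ∈ T) ∧
      Disj (fun ω => R (off T ω) a x)
        (Disj (fun ω => ∃ h : G.Adj x y, ω (ed h) = true) (fun ω => R ω y z)) ω) = 0 :=
      fun ω => ind_false fun hh => h hh.1
    simp only [this, Ex_const]
    exact le_rfl

lemma DT_bound {p : ℝ} (h0 : 0 ≤ p) (h1 : p ≤ 1) (hT : Percolation.IsTransitive G)
    (T : Finset V) {a : V} (ha : a ∉ T) (o : V) :
    X G p o ≤ Ex p (fun ω : Cf G => ((Cl (off T ω) a).card : ℝ)) +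
      p * X G p o * ∑ x, ∑ y, ind (G.Adj x y ∧ x ∉ T ∧ y ∈ T) *
        Pr p (fun ω : Cf G => R (off T ω) a x) := by
  rw [X_const p hT o a]
  rw [X_eq]
  refine (Finset.sum_le_sum fun z _ => DT_point h0 h1 T ha z).trans ?_
  rw [Finset.sum_add_distrib]
  have e1 : ∑ z, Pr p (fun ω : Cf G => R (off T ω) a z) =
      Ex p (fun ω : Cf G => ((Cl (off T ω) a).card : ℝ)) := by
    unfold Pr
    simp only [card_Cl, Ex_sum]
  rw [e1]
  gcongr
  rw [Finset.sum_comm, Finset.mul_sum]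
  apply le_of_eq
  apply Finset.sum_congr rfl; intro x _
  rw [Finset.sum_comm, Finset.mul_sum]
  apply Finset.sum_congr rfl; intro y _
  rw [← X_eq, X_const p hT a y, X_eq, Finset.mul_sum, Finset.sum_mul]
  apply Finset.sum_congr rfl; intro z _
  ring

/-! ### pivotal sums -/

lemma sum_dir (J : G.edgeSet → ℝ) :
    ∑ u, ∑ v, (if h : G.Adj u v then J (ed h) else 0) = 2 * ∑ e, J e := by
  have h1 : ∀ u v : V, (if h : G.Adj u v then J (ed h) else 0) =
      ∑ e : G.edgeSet, ind (s(u, v) = e.1) * J e := by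
    intro u v
    by_cases h : G.Adj u v
    · rw [dif_pos h, Finset.sum_eq_single (ed h)]
      · rw [ind_true (show s(u, v) = (ed h).1 from rfl), one_mul]
      · intro b _ hb
        rw [ind_false, zero_mul]
        intro h'
        exact hb (Subtype.ext h'.symm)
      · intro h'; exact absurd (Finset.mem_univ _) h'
    · rw [dif_neg h]
      symm
      apply Finset.sum_eq_zero
      intro e _
      rw [ind_false, zero_mul]
      intro h'
      apply h
      have := e.2
      rw [← h'] at this
      exact this
  simp only [h1]
  have h2 : ∀ e : G.edgeSet, ∑ u, ∑ v, ind (s(u, v) = e.1) = 2 := by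
    rintro ⟨e, he⟩
    induction e using Sym2.ind with
    | _ a b =>
      have hab : a ≠ b := (show G.Adj a b from he).ne
      have : ∀ u v : V, ind (s(u, v) = s(a, b)) =
          (if u = a then (if v = b then 1 else 0) else 0) +
          (if u = b then (if v = a then 1 else 0) else 0) := by
        intro u v
        unfold ind
        rw [Sym2.eq_iff]
        by_cases h1 : u = a
        · have : u ≠ b := by rw [h1]; exact hab
          by_cases h2 : v = b <;> simp [h1, h2, hab]
        · by_cases h3 : u = b
          · subst h3
            by_cases h2 : v = a <;> simp [h1, h2]
          · simp [h1, h3]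
      simp only [this, Finset.sum_add_distrib]
      simp
      norm_num
  calc ∑ u, ∑ v, ∑ e : G.edgeSet, ind (s(u, v) = e.1) * J e
      = ∑ e : G.edgeSet, (∑ u, ∑ v, ind (s(u, v) = e.1)) * J e := by
        simp only [Finset.sum_mul]
        rw [Finset.sum_comm' (t' := Finset.univ) (s' := fun _ => Finset.univ) (by simp)]
        rw [Finset.sum_comm]
        conv_rhs => rw [Finset.sum_comm]
        apply Finset.sum_congr rfl; intro u _
        rw [Finset.sum_comm]
    _ = _ := by simp only [h2, Finset.mul_sum]

lemma PIV {q : ℝ} (h0 : 0 ≤ q) (h1 : q ≤ 1) (f : Cf G → ℝ) (k : V → V → Cf G → ℝ)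
    (hk : ∀ u v (h : G.Adj u v) ω, k u v ω + k v u ω ≤
      if ω (ed h) then 0 else f (upd ω (ed h) true) - f ω) :
    ∑ u, ∑ v, ind (G.Adj u v) * Ex q (k u v) ≤ (1 - q) * deriv (fun q => Ex q f) q := by
  rw [← closed_deriv]
  have hd := sum_dir (fun e : G.edgeSet =>
    Ex q (fun ω => if ω e then 0 else f (upd ω e true) - f ω))
  have hs : ∑ u, ∑ v, ind (G.Adj u v) * Ex q (k u v) =
      ∑ u, ∑ v, ind (G.Adj u v) * Ex q (k v u) := by
    rw [Finset.sum_comm]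
    apply Finset.sum_congr rfl; intro u _
    apply Finset.sum_congr rfl; intro v _
    rw [ind_congr (G.adj_comm v u)]
  have h2 : 2 * ∑ u, ∑ v, ind (G.Adj u v) * Ex q (k u v) ≤
      2 * ∑ e : G.edgeSet, Ex q (fun ω => if ω e then 0 else f (upd ω e true) - f ω) := by
    rw [← hd]
    calc _ = ∑ u, ∑ v, ind (G.Adj u v) * Ex q (k u v) +
          ∑ u, ∑ v, ind (G.Adj u v) * Ex q (k v u) := by rw [← hs]; ring
      _ = ∑ u, ∑ v, (ind (G.Adj u v) * Ex q (k u v) + ind (G.Adj u v) * Ex q (k v u)) := by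
          simp only [Finset.sum_add_distrib]
      _ ≤ _ := by
          apply Finset.sum_le_sum; intro u _
          apply Finset.sum_le_sum; intro v _
          by_cases h : G.Adj u v
          · rw [dif_pos h, ind_true h, one_mul, one_mul, ← Ex_add]
            exact Ex_mono h0 h1 fun ω => hk u v h ω
          · rw [dif_neg h, ind_false h]; simp
  linarith

end Walks

end PercAux

namespace PercAux

section AN

variable {V : Type} [Fintype V] [DecidableEq V] {G : SimpleGraph V}

lemma Cl_mono {ω ω' : Cf G} (h : Le ω ω') (x : V) : Cl ω x ⊆ Cl ω' x := by
  intro y hy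
  rw [mem_Cl] at hy ⊢
  exact R_mono h hy

lemma X_nonneg {p : ℝ} (h0 : 0 ≤ p) (h1 : p ≤ 1) (x : V) : 0 ≤ X G p x :=
  Ex_nonneg h0 h1 fun _ => Nat.cast_nonneg _

lemma X_ge_one {p : ℝ} (h0 : 0 ≤ p) (h1 : p ≤ 1) (x : V) : 1 ≤ X G p x := by
  rw [← Ex_one (ι := G.edgeSet) p]
  apply Ex_mono h0 h1
  intro ω
  have : 0 < (Cl ω x).card := Finset.card_pos.2 ⟨x, mem_Cl.2 (R_refl _ _)⟩
  exact_mod_cast this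

lemma AN_piv (o u v : V) (h : G.Adj u v) (ω : Cf G) :
    ind (R ω o u ∧ ¬ R ω o v) * ((Cl ω v).card : ℝ) +
      ind (R ω o v ∧ ¬ R ω o u) * ((Cl ω u).card : ℝ) ≤
    if ω (ed h) then 0 else ((Cl (upd ω (ed h) true) o).card : ℝ) - ((Cl ω o).card : ℝ) := by
  have key : ∀ u v : V, ∀ h : G.Adj u v, (R ω o u ∧ ¬ R ω o v) →
      ((Cl ω v).card : ℝ) ≤ if ω (ed h) then 0 else
        ((Cl (upd ω (ed h) true) o).card : ℝ) - ((Cl ω o).card : ℝ) := by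
    rintro u v h ⟨hu, hv⟩
    have hc : ¬ ω (ed h) = true := fun ho => hv (R_trans hu (R_edge h ho))
    rw [if_neg hc]
    have hle := le_upd ω (ed h)
    have hsub : Cl ω o ∪ Cl ω v ⊆ Cl (upd ω (ed h) true) o := by
      apply Finset.union_subset (Cl_mono hle o)
      intro y hy
      rw [mem_Cl] at hy ⊢
      exact R_trans (R_trans (R_mono hle hu) (R_edge h (upd_self _ _ _))) (R_mono hle hy)
    have hdis : Disjoint (Cl ω o) (Cl ω v) := by
      rw [Finset.disjoint_left]
      intro y h1 h2
      rw [mem_Cl] at h1 h2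
      exact hv (R_trans h1 (R_symm h2))
    have := Finset.card_le_card hsub
    rw [Finset.card_union_of_disjoint hdis] at this
    have h3 : ((Cl ω o).card : ℝ) + ((Cl ω v).card : ℝ) ≤
      ((Cl (upd ω (ed h) true) o).card : ℝ) := by exact_mod_cast this
    linarith
  by_cases h1 : R ω o u ∧ ¬ R ω o v
  · rw [ind_true h1, ind_false (by tauto)]
    have := key u v h h1
    linarith
  · by_cases h2 : R ω o v ∧ ¬ R ω o u
    · rw [ind_true h2, ind_false h1]
      have := key v u h.symm h2
      rw [ed_symm h.symm h] at this
      linarith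
    · rw [ind_false h1, ind_false h2]
      split_ifs
      · simp
      · have := Finset.card_le_card (Cl_mono (le_upd ω (ed h)) o)
        have h3 : ((Cl ω o).card : ℝ) ≤ ((Cl (upd ω (ed h) true) o).card : ℝ) := by
          exact_mod_cast this
        linarith

lemma AN_off {q : ℝ} (h0 : 0 ≤ q) (h1 : q ≤ 1) (hT : Percolation.IsTransitive G) (o v : V)
    (A : Finset V) :
    X G q o * (1 - ∑ w ∈ A, t G q v w) ≤ Ex q (fun ω : Cf G => ((Cl (off A ω) v).card : ℝ)) := by
  have e1 : Ex q (fun ω : Cf G => ((Cl (off A ω) v).card : ℝ)) =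
      ∑ y, Pr q (fun ω : Cf G => R (off A ω) v y) := by
    unfold Pr
    simp only [card_Cl, Ex_sum]
  have e2 := Finset.sum_le_sum fun y (_ : y ∈ (Finset.univ : Finset V)) => T1 (G := G) h0 h1 A v y
  rw [← X_eq, Finset.sum_add_distrib, ← e1, Finset.sum_comm] at e2
  have e3 : ∑ w ∈ A, ∑ y, t G q v w * t G q w y = X G q o * ∑ w ∈ A, t G q v w := by
    rw [Finset.mul_sum]
    apply Finset.sum_congr rfl; intro w _
    rw [← Finset.mul_sum, ← X_eq, X_const q hT w o]; ring
  rw [e3, X_const q hT v o] at e2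
  linarith

lemma AN_k {q : ℝ} (h0 : 0 ≤ q) (h1 : q ≤ 1) (hT : Percolation.IsTransitive G) (o u v : V) :
    X G q o * (t G q o u - ∑ w, t G q v w * ∑ z, t G q o z * (t G q z u * t G q z w)) ≤
      Ex q (fun ω : Cf G => ind (R ω o u ∧ ¬ R ω o v) * ((Cl ω v).card : ℝ)) := by
  have e1 := FAC (G := G) q {o} (fun T ω => ind (u ∈ T ∧ v ∉ T) * ((Cl ω v).card : ℝ))
  have e2 : (fun ω : Cf G => ind (R ω o u ∧ ¬ R ω o v) * ((Cl ω v).card : ℝ)) =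
      fun ω : Cf G => ind (u ∈ Cg ω {o} ∧ v ∉ Cg ω {o}) *
        ((Cl (off (Cg ω {o}) ω) v).card : ℝ) := by
    ext ω
    have hi : (R ω o u ∧ ¬ R ω o v) ↔ (u ∈ Cg ω {o} ∧ v ∉ Cg ω {o}) := by
      simp [mem_Cg]
    rw [ind_congr hi]
    by_cases hv : v ∈ Cg ω {o}
    · rw [ind_false (by tauto)]; simp
    · rw [K2' hv]
  rw [e2, e1]
  have hX := X_nonneg (G := G) h0 h1 o
  have e3 : Ex q (fun ω : Cf G => X G q o * (ind (R ω o u) -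
      ∑ w, t G q v w * ind (R ω o u ∧ R ω o w))) ≤
    Ex q (fun ω : Cf G => Ex q (fun ω' : Cf G => ind (u ∈ Cg ω {o} ∧ v ∉ Cg ω {o}) *
        ((Cl (off (Cg ω {o}) ω') v).card : ℝ))) := by
    apply Ex_mono h0 h1
    intro ω
    rw [Ex_mul_left]
    have hm : ∀ x, x ∈ Cg ω {o} ↔ R ω o x := by intro x; simp [mem_Cg]
    by_cases hu : R ω o u
    · have hs : ∑ w, t G q v w * ind (R ω o u ∧ R ω o w) = ∑ w ∈ Cg ω {o}, t G q v w := by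
        unfold Cg
        rw [Finset.sum_filter]
        apply Finset.sum_congr rfl; intro w _
        unfold ind
        simp [hu]
      rw [hs, ind_true hu]
      by_cases hv : v ∈ Cg ω {o}
      · rw [ind_false (by tauto), zero_mul]
        have : t G q v v ≤ ∑ w ∈ Cg ω {o}, t G q v w :=
          Finset.single_le_sum (f := fun w => t G q v w) (fun w _ => t_nonneg h0 h1 _ _) hv
        rw [t_self] at this
        nlinarith
      · rw [ind_true ⟨(hm u).2 hu, hv⟩, one_mul]
        exact AN_off h0 h1 hT o v _
    · rw [ind_false hu, ind_false (by rw [hm]; tauto)]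
      have : ∀ w, t G q v w * ind (R ω o u ∧ R ω o w) = 0 := fun w => by
        rw [ind_false (by tauto), mul_zero]
      simp only [this]
      simp
  refine le_trans ?_ e3
  rw [Ex_mul_left, Ex_sub, Ex_sum]
  apply mul_le_mul_of_nonneg_left _ hX
  have : ∑ w, Ex q (fun ω : Cf G => t G q v w * ind (R ω o u ∧ R ω o w)) ≤
      ∑ w, t G q v w * ∑ z, t G q o z * (t G q z u * t G q z w) := by
    apply Finset.sum_le_sum; intro w _
    rw [Ex_mul_left]
    exact mul_le_mul_of_nonneg_left (T2 h0 h1 o u w) (t_nonneg h0 h1 _ _)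
  have e4 : Ex q (fun ω : Cf G => ind (R ω o u)) = t G q o u := rfl
  rw [e4]
  linarith

/-- open triangle summed over bonds, seen from `z` -/
def gz (G : SimpleGraph V) (q : ℝ) (z : V) : ℝ :=
  ∑ u, ∑ v, ∑ w, ind (G.Adj u v) * (t G q z u * t G q z w * t G q w v)

lemma gz_const (q : ℝ) (hT : Percolation.IsTransitive G) (x y : V) : gz G q x = gz G q y := by
  obtain ⟨φ, rfl⟩ := hT x y
  unfold gz
  symm
  rw [← Equiv.sum_comp φ.toEquiv]
  apply Finset.sum_congr rfl; intro u _
  rw [← Equiv.sum_comp φ.toEquiv]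
  apply Finset.sum_congr rfl; intro v _
  rw [← Equiv.sum_comp φ.toEquiv]
  apply Finset.sum_congr rfl; intro w _
  simp only [RelIso.coe_fn_toEquiv, t_aut]
  rw [ind_congr φ.map_adj_iff]

lemma gz_le {q b Ω : ℝ} (hT : Percolation.IsTransitive G)
    (hΩ : ∀ u, ∑ v, ind (G.Adj u v) = Ω)
    (htri : ∀ u v, G.Adj u v → ∑ z, ∑ w, t G q u z * t G q z w * t G q w v ≤ b) (z : V) :
    gz G q z ≤ Ω * b := by
  have h1 : ∑ z' : V, gz G q z' ≤ ∑ z' : V, Ω * b := by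
    have : ∑ z' : V, gz G q z' = ∑ u, ∑ v, ind (G.Adj u v) *
        ∑ z, ∑ w, t G q u z * t G q z w * t G q w v := by
      unfold gz
      rw [Finset.sum_comm]
      apply Finset.sum_congr rfl; intro u _
      rw [Finset.sum_comm]
      apply Finset.sum_congr rfl; intro v _
      rw [Finset.mul_sum]
      apply Finset.sum_congr rfl; intro z _
      rw [Finset.mul_sum]
      apply Finset.sum_congr rfl; intro w _
      rw [t_symm q z u]
    rw [this]
    apply Finset.sum_le_sum; intro u _
    rw [← hΩ u, Finset.sum_mul]
    apply Finset.sum_le_sum; intro v _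
    by_cases h : G.Adj u v
    · exact mul_le_mul_of_nonneg_left (htri u v h) (ind_nonneg _)
    · rw [ind_false h]; simp
  have h2 : ∀ z', gz G q z' = gz G q z := fun z' => gz_const q hT z' z
  simp only [h2, Finset.sum_const, nsmul_eq_mul] at h1
  have hV : (0 : ℝ) < (Finset.univ : Finset V).card := by
    exact_mod_cast Finset.card_pos.2 ⟨z, Finset.mem_univ z⟩
  exact le_of_mul_le_mul_left h1 hV

lemma AN {q b Ω : ℝ} (h0 : 0 ≤ q) (h1 : q ≤ 1) (hT : Percolation.IsTransitive G)
    (hΩ : ∀ u, ∑ v, ind (G.Adj u v) = Ω)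
    (htri : ∀ u v, G.Adj u v → ∑ z, ∑ w, t G q u z * t G q z w * t G q w v ≤ b) (o : V) :
    Ω * X G q o ^ 2 * (1 - b) ≤ (1 - q) * deriv (fun q => X G q o) q := by
  have hX := X_nonneg (G := G) h0 h1 o
  have h := PIV h0 h1 (fun ω : Cf G => ((Cl ω o).card : ℝ))
    (fun u v ω => ind (R ω o u ∧ ¬ R ω o v) * ((Cl ω v).card : ℝ))
    (fun u v hh ω => AN_piv o u v hh ω)
  refine le_trans ?_ h
  calc Ω * X G q o ^ 2 * (1 - b) = X G q o * (Ω * X G q o - X G q o * (Ω * b)) := by ring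
    _ ≤ X G q o * (Ω * X G q o - ∑ z, t G q o z * gz G q z) := by
        apply mul_le_mul_of_nonneg_left _ hX
        have : ∑ z, t G q o z * gz G q z ≤ X G q o * (Ω * b) := by
          rw [X_eq, Finset.sum_mul]
          apply Finset.sum_le_sum; intro z _
          exact mul_le_mul_of_nonneg_left (gz_le hT hΩ htri z) (t_nonneg h0 h1 _ _)
        linarith
    _ = ∑ u, ∑ v, ind (G.Adj u v) * (X G q o * (t G q o u -
          ∑ w, t G q v w * ∑ z, t G q o z * (t G q z u * t G q z w))) := by
        have a1 : Ω * X G q o = ∑ u, ∑ v, ind (G.Adj u v) * t G q o u := by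
          rw [X_eq, Finset.mul_sum]
          apply Finset.sum_congr rfl; intro u _
          rw [← hΩ u, Finset.sum_mul]
        have a2 : ∑ z, t G q o z * gz G q z = ∑ u, ∑ v, ind (G.Adj u v) *
            ∑ w, t G q v w * ∑ z, t G q o z * (t G q z u * t G q z w) := by
          unfold gz
          simp only [Finset.mul_sum]
          rw [Finset.sum_comm]
          apply Finset.sum_congr rfl; intro u _
          rw [Finset.sum_comm]
          apply Finset.sum_congr rfl; intro v _
          rw [Finset.sum_comm]
          apply Finset.sum_congr rfl; intro w _
          apply Finset.sum_congr rfl; intro z _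
          rw [t_symm q w v]; ring
        rw [a1, a2, ← Finset.sum_sub_distrib, Finset.mul_sum]
        apply Finset.sum_congr rfl; intro u _
        rw [← Finset.sum_sub_distrib, Finset.mul_sum]
        apply Finset.sum_congr rfl; intro v _
        ring
    _ ≤ _ := by
        apply Finset.sum_le_sum; intro u _
        apply Finset.sum_le_sum; intro v _
        exact mul_le_mul_of_nonneg_left (AN_k h0 h1 hT o u v) (ind_nonneg _)

/-- Subcritical bound on the susceptibility. -/
lemma AN_int {pc Ω : ℝ} (hc1 : pc < 1) (hT : Percolation.IsTransitive G)
    (hΩ : ∀ u, ∑ v, ind (G.Adj u v) = Ω)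
    (htri : ∀ u v, G.Adj u v → ∑ z, ∑ w, t G pc u z * t G pc z w * t G pc w v ≤ 1 / 8) (o : V)
    {q : ℝ} (h0 : 0 ≤ q) (hq : q ≤ pc) :
    X G q o * (Ω / 2 * (pc - q)) ≤ 1 := by
  have hΩ0 : 0 ≤ Ω := by rw [← hΩ o]; exact Finset.sum_nonneg fun v _ => ind_nonneg _
  have hmon : MonotoneOn (fun q => -(X G q o)⁻¹ - Ω / 2 * q) (Set.Icc 0 pc) := by
    have hd : ∀ x ∈ Set.Icc 0 pc, HasDerivAt (fun q => -(X G q o)⁻¹ - Ω / 2 * q)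
        (deriv (fun q => X G q o) x / X G x o ^ 2 - Ω / 2) x := by
      intro x hx
      have h1 : HasDerivAt (fun q => X G q o) (deriv (fun q => X G q o) x) x :=
        (differentiable_Ex (fun ω : Cf G => ((Cl ω o).card : ℝ)) x).hasDerivAt
      have hne : X G x o ≠ 0 := by
        have := X_ge_one (G := G) hx.1 (hx.2.trans hc1.le) o
        linarith
      have h2 := (h1.fun_inv hne).neg
      have h3 : HasDerivAt (fun q : ℝ => Ω / 2 * q) (Ω / 2) x := by
        simpa using (hasDerivAt_id x).const_mul (Ω / 2)
      have h4 := h2.sub h3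
      have e : -(-deriv (fun q => X G q o) x / X G x o ^ 2) - Ω / 2 =
        deriv (fun q => X G q o) x / X G x o ^ 2 - Ω / 2 := by ring
      rw [e] at h4
      exact h4
    apply monotoneOn_of_deriv_nonneg (convex_Icc 0 pc)
    · exact fun x hx => (hd x hx).continuousAt.continuousWithinAt
    · intro x hx
      exact (hd x (interior_subset hx)).differentiableAt.differentiableWithinAt
    · intro x hx
      have hx' := interior_subset hx
      rw [(hd x hx').deriv]
      have hx1 : x ≤ 1 := hx'.2.trans hc1.le
      have hX1 := X_ge_one (G := G) hx'.1 hx1 o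
      have hAN := AN (b := 1 / 8) hx'.1 hx1 hT hΩ (fun u v h => by
        refine le_trans ?_ (htri u v h)
        apply Finset.sum_le_sum; intro z _
        apply Finset.sum_le_sum; intro w _
        have m := fun x y : V => t_mono (G := G) hx'.1 hx'.2 hc1.le x y
        have n := fun x y : V => t_nonneg (G := G) hx'.1 hx1 x y
        have n' := fun x y : V => (n x y).trans (m x y)
        exact mul_le_mul (mul_le_mul (m _ _) (m _ _) (n _ _) (n' _ _)) (m _ _) (n _ _)
          (mul_nonneg (n' _ _) (n' _ _))) o
      have hs : 0 ≤ Ω * X G x o ^ 2 := by positivity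
      have h5 : Ω * X G x o ^ 2 / 2 ≤ deriv (fun q => X G q o) x := by
        have h6 : 0 < 1 - x := by linarith [hx'.2]
        have h7 : 0 ≤ deriv (fun q => X G q o) x := by
          by_contra hneg
          push Not at hneg
          nlinarith
        nlinarith [hx'.1]
      rw [sub_nonneg, le_div_iff₀ (by positivity)]
      linarith
  have hc0 : 0 ≤ pc := h0.trans hq
  have := hmon ⟨h0, hq⟩ ⟨hc0, le_rfl⟩ hq
  simp only at this
  have hX1 := X_ge_one (G := G) h0 (hq.trans hc1.le) o
  have hX2 := X_ge_one (G := G) hc0 hc1.le o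
  have h8 : 0 < (X G pc o)⁻¹ := by positivity
  have h9 : Ω / 2 * (pc - q) ≤ (X G q o)⁻¹ := by linarith
  calc X G q o * (Ω / 2 * (pc - q)) ≤ X G q o * (X G q o)⁻¹ := by gcongr
    _ = 1 := mul_inv_cancel₀ (by linarith)

end AN

end PercAux

namespace PercAux

section Fisher

variable {V : Type} [Fintype V] [DecidableEq V] {G : SimpleGraph V}

/-- truncated susceptibility -/
def F (G : SimpleGraph V) (q n : ℝ) (x : V) : ℝ :=
  Ex q (fun ω : Cf G => min ((Cl ω x).card : ℝ) n)

/-- intrinsic ball -/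
def Bl (ω : Cf G) (x : V) : ℕ → Finset V
  | 0 => {x}
  | r + 1 => Finset.univ.filter fun z => z ∈ Bl ω x r ∨
      ∃ y ∈ Bl ω x r, ∃ h : G.Adj y z, ω (ed h) = true

lemma mem_Bl_succ {ω : Cf G} {x z : V} {r : ℕ} : z ∈ Bl ω x (r + 1) ↔ z ∈ Bl ω x r ∨
      ∃ y ∈ Bl ω x r, ∃ h : G.Adj y z, ω (ed h) = true := by
  simp [Bl]

lemma Bl_mono (ω : Cf G) (x : V) : Monotone (Bl ω x) := by
  apply monotone_nat_of_le_succ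
  intro r z hz
  exact mem_Bl_succ.2 (Or.inl hz)

lemma Bl_Cl {ω : Cf G} {x z : V} : R ω x z ↔ ∃ r, z ∈ Bl ω x r := by
  constructor
  · intro h
    apply R_ind (P := fun z => ∃ r, z ∈ Bl ω x r) ⟨0, by simp [Bl]⟩ _ z h
    rintro y z _ ⟨r, hr⟩ hadj ho
    exact ⟨r + 1, mem_Bl_succ.2 (Or.inr ⟨y, hr, hadj, ho⟩)⟩
  · rintro ⟨r, hr⟩
    induction r generalizing z with
    | zero => simp [Bl] at hr; rw [hr]; exact R_refl _ _
    | succ r ih =>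
      rcases mem_Bl_succ.1 hr with h | ⟨y, hy, hadj, ho⟩
      · exact ih h
      · exact R_trans (ih hy) (R_edge hadj ho)

lemma Bl_sub (ω : Cf G) (x : V) (r : ℕ) : Bl ω x r ⊆ Cl ω x := by
  intro z hz
  rw [mem_Cl]; exact Bl_Cl.2 ⟨r, hz⟩

lemma Bl_key {ω ω' : Cf G} {x : V} {e : G.edgeSet} {r : ℕ} (hag : AgreeOff e ω ω')
    (h : ∀ k < r, ¬ touch (Bl ω x k) e) : ∀ k ≤ r, Bl ω' x k = Bl ω x k := by
  intro k
  induction k with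
  | zero => intro _; rfl
  | succ k ih =>
    intro hk
    have ih' := ih (by omega)
    have hnt := h k (by omega)
    ext z
    rw [mem_Bl_succ, mem_Bl_succ, ih']
    have : ∀ y ∈ Bl ω x k, ∀ hadj : G.Adj y z, ω (ed hadj) = ω' (ed hadj) := by
      intro y hy hadj
      apply hag
      intro he
      apply hnt
      rw [← he, touch_mk]
      exact Or.inl hy
    constructor
    · rintro (h | ⟨y, hy, hadj, ho⟩)
      · exact Or.inl h
      · exact Or.inr ⟨y, hy, hadj, by rw [this y hy hadj]; exact ho⟩
    · rintro (h | ⟨y, hy, hadj, ho⟩)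
      · exact Or.inl h
      · exact Or.inr ⟨y, hy, hadj, by rw [← this y hy hadj]; exact ho⟩

/-- edge `e` is explored at step `r` -/
def Xp (x : V) (n : ℝ) (r : ℕ) (e : G.edgeSet) (ω : Cf G) : Prop :=
  touch (Bl ω x r) e ∧ (∀ k < r, ¬ touch (Bl ω x k) e) ∧ ((Bl ω x r).card : ℝ) < n

lemma sum_ind_mem (T : Finset V) : ∑ u, ind (u ∈ T) = (T.card : ℝ) := by
  rw [Finset.card_eq_sum_ones, Nat.cast_sum, ← Finset.sum_subset (Finset.subset_univ T)
    (f := fun u => ind (u ∈ T)) (fun u _ hu => ind_false hu)]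
  apply Finset.sum_congr rfl
  intro u hu
  simp [ind_true hu]

lemma touch_sum {Ω : ℝ} (hΩ : ∀ u, ∑ v, ind (G.Adj u v) = Ω) (T : Finset V) :
    ∑ e : G.edgeSet, ind (touch T e) ≤ Ω * T.card := by
  have h := sum_dir (fun e : G.edgeSet => ind (touch T e))
  have hT : ∑ u, ind (u ∈ T) = (T.card : ℝ) := sum_ind_mem T
  have h1 : ∑ u, ∑ v, ind (G.Adj u v) * ind (u ∈ T) = Ω * T.card := by
    simp only [← Finset.sum_mul, hΩ, ← Finset.mul_sum, hT]
  have h2 : ∑ u, ∑ v, ind (G.Adj u v) * ind (v ∈ T) = Ω * T.card := by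
    rw [← h1, Finset.sum_comm]
    apply Finset.sum_congr rfl; intro u _
    apply Finset.sum_congr rfl; intro v _
    rw [ind_congr (G.adj_comm v u)]
  have h3 : ∑ u, ∑ v, (if h : G.Adj u v then ind (touch T (ed h)) else 0) ≤
      ∑ u, ∑ v, (ind (G.Adj u v) * ind (u ∈ T) + ind (G.Adj u v) * ind (v ∈ T)) := by
    apply Finset.sum_le_sum; intro u _
    apply Finset.sum_le_sum; intro v _
    by_cases h : G.Adj u v
    · rw [dif_pos h, ind_true h, ind_congr (touch_mk h)]
      by_cases hu : u ∈ T
      · rw [ind_true (Or.inl hu), ind_true hu]; linarith [ind_nonneg (v ∈ T)]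
      · by_cases hv : v ∈ T
        · rw [ind_true (Or.inr hv), ind_true hv]; linarith [ind_nonneg (u ∈ T)]
        · rw [ind_false (by tauto), ind_false hu, ind_false hv]; norm_num
    · rw [dif_neg h, ind_false h]; simp
  simp only [Finset.sum_add_distrib, h1, h2] at h3
  linarith

lemma explored_le {Ω : ℝ} (hΩ : ∀ u, ∑ v, ind (G.Adj u v) = Ω) (hΩ0 : 0 ≤ Ω) {n : ℝ} (hn : 0 ≤ n)
    (x : V) (ω : Cf G) :
    ∑ e, ind (∃ r, Xp x n r e ω) ≤ Ω * min ((Cl ω x).card : ℝ) n := by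
  by_cases hne : ∃ e r, Xp x n r e ω
  · choose! ρ hρ using fun e (h : ∃ r, Xp x n r e ω) => h
    obtain ⟨e0, r0, h0⟩ := hne
    obtain ⟨e1, he1, hmax⟩ := Finset.exists_max_image
      (Finset.univ.filter fun e : G.edgeSet => ∃ r, Xp x n r e ω) ρ
      ⟨e0, by simp only [Finset.mem_filter, Finset.mem_univ, true_and]; exact ⟨r0, h0⟩⟩
    simp only [Finset.mem_filter, Finset.mem_univ, true_and] at he1 hmax
    have hX := hρ e1 he1
    calc ∑ e, ind (∃ r, Xp x n r e ω) ≤ ∑ e, ind (touch (Bl ω x (ρ e1)) e) := by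
          apply Finset.sum_le_sum; intro e _
          apply ind_mono
          intro he
          obtain ⟨v, hv, hm⟩ := (hρ e he).1
          exact ⟨v, Bl_mono ω x (hmax e he) hv, hm⟩
      _ ≤ Ω * (Bl ω x (ρ e1)).card := touch_sum hΩ _
      _ ≤ _ := by
          apply mul_le_mul_of_nonneg_left _ hΩ0
          apply le_min
          · exact_mod_cast Finset.card_le_card (Bl_sub ω x _)
          · exact hX.2.2.le
  · have : ∀ e, ind (∃ r, Xp x n r e ω) = 0 := fun e => ind_false fun ⟨r, h⟩ => hne ⟨e, r, h⟩
    simp only [this, Finset.sum_const_zero]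
    positivity

lemma F_nonneg {q n : ℝ} (h0 : 0 ≤ q) (h1 : q ≤ 1) (hn : 0 ≤ n) (x : V) : 0 ≤ F G q n x :=
  Ex_nonneg h0 h1 fun _ => le_min (Nat.cast_nonneg _) hn

lemma F_deriv {Ω : ℝ} (hΩ : ∀ u, ∑ v, ind (G.Adj u v) = Ω) (hΩ0 : 0 ≤ Ω) {n q : ℝ} (hn : 0 ≤ n)
    (h0 : 0 < q) (h1 : q < 1) (x : V) :
    (deriv (fun q => F G q n x) q) ^ 2 ≤ n * Ω / (q * (1 - q)) * F G q n x ^ 2 := by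
  have hf := fisher h0 h1 (fun r e (ω : Cf G) => Xp x n r e ω) (by
      rintro r k e ω ⟨h1, h2, h3⟩ ⟨h4, h5, h6⟩
      rcases lt_trichotomy r k with h | h | h
      · exact absurd h1 (h5 r h)
      · exact h
      · exact absurd h4 (h2 k h)) (by
      rintro r k e e' ω ω' hkr hX ⟨h4, h5, h6⟩ hag
      have hk := Bl_key hag hX.2.1
      refine ⟨?_, ?_, ?_⟩
      · rw [hk k hkr]; exact h4
      · intro j hj; rw [hk j (by omega)]; exact h5 j hj
      · rw [hk k hkr]; exact h6)
    (fun ω => min ((Cl ω x).card : ℝ) n) (by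
      intro e ω ω' hag hno
      by_cases ht : ∃ r, touch (Bl ω x r) e
      · have hr := Nat.find_spec ht
        have hmin : ∀ k < Nat.find ht, ¬ touch (Bl ω x k) e := fun k hk => Nat.find_min ht hk
        have hcard : n ≤ ((Bl ω x (Nat.find ht)).card : ℝ) := by
          by_contra hlt
          push Not at hlt
          exact hno ⟨_, hr, hmin, hlt⟩
        have hk := Bl_key hag hmin _ le_rfl
        have c1 : ((Bl ω x (Nat.find ht)).card : ℝ) ≤ (Cl ω x).card := by
          exact_mod_cast Finset.card_le_card (Bl_sub ω x _)
        have c2 : ((Bl ω x (Nat.find ht)).card : ℝ) ≤ (Cl ω' x).card := by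
          rw [← hk]
          exact_mod_cast Finset.card_le_card (Bl_sub ω' x _)
        rw [min_eq_right (hcard.trans c1), min_eq_right (hcard.trans c2)]
      · have hk : ∀ k, Bl ω' x k = Bl ω x k := fun k =>
          Bl_key hag (r := k) (fun j _ hj => ht ⟨j, hj⟩) k le_rfl
        have : Cl ω x = Cl ω' x := by
          ext z
          rw [mem_Cl, mem_Cl, Bl_Cl, Bl_Cl]
          simp only [hk]
        rw [this])
  refine hf.trans ?_
  have hq : 0 < q * (1 - q) := mul_pos h0 (by linarith)
  have hF := F_nonneg (G := G) h0.le h1.le hn x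
  have a1 : Ex q (fun ω : Cf G => min ((Cl ω x).card : ℝ) n ^ 2) ≤ n * F G q n x := by
    unfold F
    rw [← Ex_mul_left]
    apply Ex_mono h0.le h1.le
    intro ω
    have b1 : min ((Cl ω x).card : ℝ) n ≤ n := min_le_right _ _
    have b2 : 0 ≤ min ((Cl ω x).card : ℝ) n := le_min (Nat.cast_nonneg _) hn
    nlinarith
  have a2 : Ex q (fun ω : Cf G => ∑ e, ind (∃ r, Xp x n r e ω)) ≤ Ω * F G q n x := by
    unfold F
    rw [← Ex_mul_left]
    exact Ex_mono h0.le h1.le fun ω => explored_le hΩ hΩ0 hn x ω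
  have a3 : 0 ≤ Ex q (fun ω : Cf G => ∑ e, ind (∃ r, Xp x n r e ω)) :=
    Ex_nonneg h0.le h1.le fun ω => Finset.sum_nonneg fun e _ => ind_nonneg _
  calc _ ≤ (n * F G q n x) * (Ω * F G q n x) / (q * (1 - q)) := by
        gcongr
    _ = _ := by ring

lemma F_growth {Ω : ℝ} (hΩ : ∀ u, ∑ v, ind (G.Adj u v) = Ω) (hΩ0 : 0 < Ω) {n q0 p : ℝ}
    (hn : 0 ≤ n) (h0 : 0 < q0) (hqp : q0 ≤ p) (h1 : p ≤ 1 / 2) (hq : 7 / 16 ≤ Ω * q0) (x : V) :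
    F G p n x ≤ F G q0 n x * Real.exp (3 * Ω * Real.sqrt n * (p - q0)) := by
  set c := 3 * Ω * Real.sqrt n with hc
  have hd : ∀ q, HasDerivAt (fun q => F G q n x) (deriv (fun q => F G q n x) q) q := fun q =>
    (differentiable_Ex (fun ω : Cf G => min ((Cl ω x).card : ℝ) n) q).hasDerivAt
  have hbound : ∀ q ∈ Set.Icc q0 p, deriv (fun q => F G q n x) q ≤ c * F G q n x := by
    intro q hq'
    have hq0 : 0 < q := h0.trans_le hq'.1
    have hq1 : q ≤ 1 / 2 := hq'.2.trans h1
    have hFn := F_nonneg (G := G) hq0.le (by linarith) hn x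
    have h := F_deriv hΩ hΩ0.le hn hq0 (by linarith) x
    have hpos : 0 < q * (1 - q) := mul_pos hq0 (by linarith)
    have hc2 : n * Ω / (q * (1 - q)) ≤ c ^ 2 := by
      rw [div_le_iff₀ hpos, hc, mul_pow, Real.sq_sqrt hn]
      have h3 : 7 / 16 ≤ Ω * q := hq.trans (by gcongr; exact hq'.1)
      have h4 : 1 ≤ 9 * (Ω * q * (1 - q)) := by nlinarith
      have h5 : 0 ≤ n * Ω := by positivity
      nlinarith
    apply le_of_sq_le_sq
    · calc _ ≤ _ := h
        _ ≤ c ^ 2 * F G q n x ^ 2 := by gcongr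
        _ = _ := by ring
    · positivity
  have hanti : AntitoneOn (fun q => F G q n x * Real.exp (-(c * q))) (Set.Icc q0 p) := by
    have hdd : ∀ q, HasDerivAt (fun q => F G q n x * Real.exp (-(c * q)))
        (deriv (fun q => F G q n x) q * Real.exp (-(c * q)) +
          F G q n x * (Real.exp (-(c * q)) * (-c))) q := by
      intro q
      apply (hd q).fun_mul
      apply HasDerivAt.exp
      have h := ((hasDerivAt_id q).const_mul c).fun_neg
      simpa using h
    apply antitoneOn_of_deriv_nonpos (convex_Icc q0 p)
    · exact fun q _ => (hdd q).continuousAt.continuousWithinAt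
    · exact fun q _ => (hdd q).differentiableAt.differentiableWithinAt
    · intro q hq'
      rw [(hdd q).deriv]
      have := hbound q (interior_subset hq')
      have he := Real.exp_pos (-(c * q))
      nlinarith
  have := hanti ⟨le_rfl, hqp⟩ ⟨hqp, le_rfl⟩ hqp
  simp only at this
  have he : Real.exp (c * (p - q0)) = Real.exp (-(c * q0)) * Real.exp (c * p) := by
    rw [← Real.exp_add]; congr 1; ring
  have he2 : Real.exp (-(c * p)) * Real.exp (c * p) = 1 := by
    rw [← Real.exp_add]; simp
  calc F G p n x = F G p n x * Real.exp (-(c * p)) * Real.exp (c * p) := by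
        rw [mul_assoc, he2, mul_one]
    _ ≤ F G q0 n x * Real.exp (-(c * q0)) * Real.exp (c * p) := by gcongr
    _ = _ := by rw [he]; ring

end Fisher

section Params

variable {V : Type} [Fintype V] [DecidableEq V] {G : SimpleGraph V}

/-- Standing assumptions on the critical point. -/
structure Crit (G : SimpleGraph V) (Ω pc : ℝ) (o : V) : Prop where
  trans : Percolation.IsTransitive G
  deg : ∀ u, ∑ v, ind (G.Adj u v) = Ω
  pos : 0 < pc
  lt_one : pc < 1
  tri : ∀ u v, G.Adj u v → ∑ z, ∑ w, t G pc u z * t G pc z w * t G pc w v ≤ 1 / 8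
  chi : 8 ≤ X G pc o

variable {Ω pc : ℝ} {o : V}

lemma Crit.Omega_nonneg (h : Crit G Ω pc o) : 0 ≤ Ω := by
  rw [← h.deg o]; exact Finset.sum_nonneg fun v _ => ind_nonneg _

lemma Crit.lower (h : Crit G Ω pc o) : 7 / 8 ≤ Ω * pc := by
  have hDT := DT_bound h.pos.le h.lt_one.le h.trans (Finset.univ.erase o) (a := o) (by simp) o
  have e1 : Ex pc (fun ω : Cf G => ((Cl (off (Finset.univ.erase o) ω) o).card : ℝ)) = 1 := by
    rw [← Ex_one (ι := G.edgeSet) pc]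
    congr 1
    ext ω
    have : Cl (off (Finset.univ.erase o) ω) o = {o} := by
      ext z
      rw [mem_Cl, Finset.mem_singleton]
      constructor
      · intro hz
        have := off_notMem (by simp) hz
        simpa using this
      · rintro rfl; exact R_refl _ _
    rw [this]; simp
  have e2 : ∑ x, ∑ y, ind (G.Adj x y ∧ x ∉ Finset.univ.erase o ∧ y ∈ Finset.univ.erase o) *
        Pr pc (fun ω : Cf G => R (off (Finset.univ.erase o) ω) o x) ≤ Ω := by
    rw [Finset.sum_eq_single o]
    · rw [← h.deg o]
      apply Finset.sum_le_sum; intro y _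
      rw [Pr_true pc (fun ω => R_refl _ _), mul_one]
      exact ind_mono fun hh => hh.1
    · intro x _ hx
      apply Finset.sum_eq_zero; intro y _
      rw [ind_false, zero_mul]
      rintro ⟨-, hh, -⟩
      exact hh (by simp [hx])
    · intro hh; exact absurd (Finset.mem_univ _) hh
  rw [e1] at hDT
  have hX := h.chi
  have hp := h.pos
  have : X G pc o ≤ 1 + pc * X G pc o * Ω := by
    refine hDT.trans ?_
    gcongr
  nlinarith

lemma Crit.Omega_pos (h : Crit G Ω pc o) : 0 < Ω := by
  have h1 := h.lower
  rcases h.Omega_nonneg.lt_or_eq with h' | h'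
  · exact h'
  · rw [← h'] at h1; norm_num at h1

lemma Crit.pc_le (h : Crit G Ω pc o) : pc ≤ 1 / 8 := by
  have hpos := h.Omega_pos
  rw [← h.deg o] at hpos
  obtain ⟨v, -, hv⟩ := Finset.exists_ne_zero_of_sum_ne_zero hpos.ne'
  have hadj : G.Adj o v := by
    by_contra hn
    exact hv (ind_false hn)
  have h0 := h.pos.le
  have h1 := h.lt_one.le
  have ht : Pr pc (fun ω : Cf G => ω (ed hadj) = true) ≤ t G pc o v :=
    Pr_mono h0 h1 fun ω ho => R_edge hadj ho
  rw [Pr_open] at ht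
  have hnn : ∀ z w, 0 ≤ t G pc o z * t G pc z w * t G pc w v := fun z w =>
    mul_nonneg (mul_nonneg (t_nonneg h0 h1 _ _) (t_nonneg h0 h1 _ _)) (t_nonneg h0 h1 _ _)
  have h2 := Finset.single_le_sum (f := fun z => ∑ w, t G pc o z * t G pc z w * t G pc w v)
    (fun z _ => Finset.sum_nonneg fun w _ => hnn z w) (Finset.mem_univ o)
  have h3 := Finset.single_le_sum (f := fun w => t G pc o o * t G pc o w * t G pc w v)
    (fun w _ => hnn o w) (Finset.mem_univ o)
  have h4 := h.tri o v hadj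
  simp only [t_self, one_mul] at h2 h3
  linarith

lemma Crit.upper (h : Crit G Ω pc o) : Ω * pc ≤ 2 := by
  have h1 := AN_int h.lt_one h.trans h.deg h.tri o le_rfl h.pos.le
  have h2 := X_ge_one (G := G) (le_refl (0 : ℝ)) zero_le_one o
  have h3 : 0 ≤ Ω * pc := mul_nonneg h.Omega_nonneg h.pos.le
  nlinarith

lemma Crit.seven (h : Crit G Ω pc o) : 7 ≤ Ω := by
  have h1 := h.lower
  have h2 := h.pc_le
  have h3 := h.Omega_pos
  nlinarith

lemma F_le_scale {q : ℝ} (h0 : 0 ≤ q) (h1 : q ≤ 1) {n N : ℝ} (hn : 0 < n) (hN : n ≤ N) (x : V) :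
    F G q N x ≤ N / n * F G q n x := by
  unfold F
  rw [← Ex_mul_left]
  apply Ex_mono h0 h1
  intro ω
  have hm : (0 : ℝ) ≤ (Cl ω x).card := Nat.cast_nonneg _
  rw [div_mul_eq_mul_div, le_div_iff₀ hn]
  rcases le_total ((Cl ω x).card : ℝ) n with h | h
  · rw [min_eq_left h, min_eq_left (h.trans hN)]; nlinarith
  · rw [min_eq_right h]
    have := min_le_right ((Cl ω x).card : ℝ) N
    nlinarith

lemma F_le_n {q : ℝ} (h0 : 0 ≤ q) (h1 : q ≤ 1) (n : ℝ) (x : V) : F G q n x ≤ n := by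
  calc F G q n x ≤ Ex q (fun _ : Cf G => n) := Ex_mono h0 h1 fun _ => min_le_right _ _
    _ = n := Ex_const q n

lemma F_le_X {q : ℝ} (h0 : 0 ≤ q) (h1 : q ≤ 1) (n : ℝ) (x : V) : F G q n x ≤ X G q x :=
  Ex_mono h0 h1 fun _ => min_le_left _ _

lemma Crit.p_half (h : Crit G Ω pc o) {ε : ℝ} (hε1 : ε ≤ 1) : pc + ε / Ω ≤ 1 / 2 := by
  have h2 := h.pc_le
  have h3 := h.seven
  have : ε / Ω ≤ 1 / 7 := by
    rw [div_le_iff₀ h.Omega_pos]; nlinarith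
  linarith

/-- Supercritical bound on the truncated susceptibility. -/
lemma Crit.F_bound (h : Crit G Ω pc o) {ε : ℝ} (hε : 0 < ε) (hε1 : ε ≤ 1) {N : ℝ}
    (hN : 1 / (144 * ε ^ 2) ≤ N) : F G (pc + ε / Ω) N o ≤ 576 * ε * N := by
  have hΩ := h.Omega_pos
  have hp := h.p_half hε1
  have hN0 : 0 < N := lt_of_lt_of_le (by positivity) hN
  have hpp : 0 < pc + ε / Ω := add_pos h.pos (by positivity)
  by_cases hbig : 7 / 16 < ε
  · have := F_le_n (G := G) hpp.le (by linarith) N o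
    nlinarith
  · push Not at hbig
    set n := 1 / (144 * ε ^ 2) with hn
    have hn0 : 0 < n := by positivity
    have hq : 7 / 16 ≤ Ω * (pc - ε / Ω) := by
      have := h.lower
      have e : Ω * (pc - ε / Ω) = Ω * pc - ε := by field_simp
      rw [e]; linarith
    have hq0 : 0 < pc - ε / Ω := by
      by_contra hcon
      push Not at hcon
      nlinarith
    have hle : pc - ε / Ω ≤ pc := by linarith [show 0 < ε / Ω by positivity]
    have hg := F_growth (G := G) h.deg hΩ hn0.le hq0 (p := pc + ε / Ω)
      (by linarith [show 0 < ε / Ω by positivity]) hp hq o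
    have hsq : Real.sqrt n = 1 / (12 * ε) := by
      rw [hn, show 1 / (144 * ε ^ 2) = (1 / (12 * ε)) ^ 2 by field_simp; norm_num]
      exact Real.sqrt_sq (by positivity)
    have hexp : Real.exp (3 * Ω * Real.sqrt n * (pc + ε / Ω - (pc - ε / Ω))) ≤ 2 := by
      have e : 3 * Ω * Real.sqrt n * (pc + ε / Ω - (pc - ε / Ω)) = 1 / 2 := by
        rw [hsq]; field_simp; ring
      rw [e]
      have h1 := Real.exp_one_lt_d9
      have h2 : Real.exp (1 / 2) * Real.exp (1 / 2) = Real.exp 1 := by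
        rw [← Real.exp_add]; norm_num
      by_contra hcon
      push Not at hcon
      nlinarith
    have hX := AN_int h.lt_one h.trans h.deg h.tri o hq0.le hle
    have e2 : Ω / 2 * (pc - (pc - ε / Ω)) = ε / 2 := by field_simp; ring
    rw [e2] at hX
    have hX2 : X G (pc - ε / Ω) o ≤ 2 / ε := by
      rw [le_div_iff₀ hε]; linarith
    have hlt := h.lt_one
    have hF0 := F_le_X (G := G) hq0.le (by linarith) n o
    have hFp := F_nonneg (G := G) hq0.le (by linarith : pc - ε / Ω ≤ 1) hn0.le o
    have hF1 : F G (pc + ε / Ω) n o ≤ 4 / ε := by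
      calc _ ≤ _ := hg
        _ ≤ F G (pc - ε / Ω) n o * 2 := by gcongr
        _ ≤ 2 / ε * 2 := by gcongr; exact hF0.trans hX2
        _ = _ := by ring
    calc _ ≤ N / n * F G (pc + ε / Ω) n o := F_le_scale hpp.le (by linarith) hn0 hN o
      _ ≤ N / n * (4 / ε) := by gcongr
      _ = 576 * ε * N := by rw [hn]; field_simp; norm_num

end Params

end PercAux

namespace PercAux

section Lower

variable {V : Type} [Fintype V] [DecidableEq V] {G : SimpleGraph V}

/-- The pivotality functional for the event `o ∈ Cg ω g`. -/
def kk (o : V) (g : Finset V) (u v : V) (ω : Cf G) : ℝ :=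
  ind ((o ∉ Cg ω g ∧ v ∈ Cg ω g) ∧ R ω o u)

lemma kk_eq (q : ℝ) (o : V) (g : Finset V) (u v : V) :
    Ex q (kk (G := G) o g u v) = Ex q (fun ω : Cf G => ind (o ∉ Cg ω g ∧ v ∈ Cg ω g) *
      Pr q (fun ω' : Cf G => R (off (Cg ω g) ω') o u)) := by
  have h := FAC (G := G) q g (fun T ω => ind (o ∉ T ∧ v ∈ T) * ind (R ω o u))
  simp only [Ex_mul_left] at h
  unfold Pr
  rw [← h]
  congr 1
  ext ω
  unfold kk
  rw [ind_and]
  by_cases ho : o ∈ Cg ω g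
  · rw [ind_false (by tauto), zero_mul, zero_mul]
  · rw [ind_congr (K2 ho)]

lemma kk_pair {o : V} {g : Finset V} {u v : V} (h : G.Adj u v) (ω : Cf G) :
    kk o g u v ω + kk o g v u ω ≤ if ω (ed h) then 0 else
      ind (o ∈ Cg (upd ω (ed h) true) g) - ind (o ∈ Cg ω g) := by
  have key : ∀ {u v : V} (h : G.Adj u v), ((o ∉ Cg ω g ∧ v ∈ Cg ω g) ∧ R ω o u) →
      ω (ed h) = false ∧ o ∈ Cg (upd ω (ed h) true) g := by
    rintro u v h ⟨⟨h1, h2⟩, h3⟩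
    constructor
    · by_contra hne
      have ho : ω (ed h) = true := by simpa using hne
      exact h1 (Cg_step h2 (R_symm (R_trans h3 (R_edge h ho))))
    · obtain ⟨a, ha, hR⟩ := mem_Cg.1 h2
      refine mem_Cg.2 ⟨a, ha, ?_⟩
      have hl := le_upd ω (ed h)
      exact R_trans (R_mono hl hR) (R_symm (R_trans (R_mono hl h3) (R_edge h (upd_self _ _ _))))
  have hmono : ind (o ∈ Cg ω g) ≤ ind (o ∈ Cg (upd ω (ed h) true) g) := by
    apply ind_mono
    intro ho
    obtain ⟨a, ha, hR⟩ := mem_Cg.1 ho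
    exact mem_Cg.2 ⟨a, ha, R_mono (le_upd ω _) hR⟩
  unfold kk
  by_cases h1 : (o ∉ Cg ω g ∧ v ∈ Cg ω g) ∧ R ω o u
  · obtain ⟨h2, h3⟩ := key h h1
    have h4 : ¬ ((o ∉ Cg ω g ∧ u ∈ Cg ω g) ∧ R ω o v) := by
      rintro ⟨⟨-, h5⟩, -⟩
      exact h1.1.1 (Cg_step h5 (R_symm h1.2))
    rw [ind_true h1, ind_false h4, h2, ind_true h3, ind_false h1.1.1]
    simp
  · by_cases h4 : (o ∉ Cg ω g ∧ u ∈ Cg ω g) ∧ R ω o v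
    · obtain ⟨h2, h3⟩ := key h.symm h4
      rw [ed_symm h.symm h] at h2 h3
      rw [ind_true h4, ind_false h1, h2, ind_true h3, ind_false h4.1.1]
      simp
    · rw [ind_false h1, ind_false h4]
      split_ifs
      · simp
      · linarith

lemma off_card_mono {pc q : ℝ} (h0 : 0 ≤ pc) (h : pc ≤ q) (h1 : q ≤ 1) (T : Finset V) (o : V) :
    Ex pc (fun ω : Cf G => ((Cl (off T ω) o).card : ℝ)) ≤
      Ex q (fun ω : Cf G => ((Cl (off T ω) o).card : ℝ)) := by
  simp only [card_Cl, Ex_sum]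
  exact Finset.sum_le_sum fun y _ => Pr_mono_p (off_inc T o y) h0 h h1

lemma ghost_g {Ω pc : ℝ} {o : V} (hc : Crit G Ω pc o) {q : ℝ} (hq : pc ≤ q) (h1 : q ≤ 1)
    (g : Finset V) :
    X G pc o * Ex q (fun ω : Cf G => ind (o ∉ Cg ω g)) ≤
      Ex q (fun ω : Cf G => ind (o ∉ Cg ω g) * ((Cl ω o).card : ℝ)) +
      pc * X G pc o * ∑ u, ∑ v, ind (G.Adj u v) * Ex q (kk (G := G) o g u v) := by
  have h0 := hc.pos.le
  have hq0 : 0 ≤ q := h0.trans hq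
  have hX := X_nonneg (G := G) h0 hc.lt_one.le o
  have hcard : Ex q (fun ω : Cf G => ind (o ∉ Cg ω g) * ((Cl ω o).card : ℝ)) =
      Ex q (fun ω : Cf G => ind (o ∉ Cg ω g) *
        Ex q (fun ω' : Cf G => ((Cl (off (Cg ω g) ω') o).card : ℝ))) := by
    have h := FAC (G := G) q g (fun T ω => ind (o ∉ T) * ((Cl ω o).card : ℝ))
    simp only [Ex_mul_left] at h
    rw [← h]
    congr 1
    ext ω
    by_cases ho : o ∈ Cg ω g
    · rw [ind_false (by tauto), zero_mul, zero_mul]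
    · rw [← K2' ho]
  rw [hcard]
  simp only [kk_eq, ← Ex_mul_left, ← Ex_sum, ← Ex_add]
  apply Ex_mono hq0 h1
  intro ω
  by_cases ho : o ∈ Cg ω g
  · rw [ind_false (by tauto)]
    simp only [mul_zero, zero_mul, Ex_const, zero_add]
    refine mul_nonneg (mul_nonneg h0 hX) ?_
    exact Finset.sum_nonneg fun u _ => Finset.sum_nonneg fun v _ =>
      mul_nonneg (ind_nonneg _) (mul_nonneg (ind_nonneg _) (Pr_nonneg hq0 h1 _))
  · rw [ind_true ho, mul_one]
    simp only [one_mul]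
    refine (DT_bound h0 hc.lt_one.le hc.trans (Cg ω g) ho o).trans ?_
    have hcm := off_card_mono (G := G) h0 hq h1 (Cg ω g) o
    refine add_le_add hcm (mul_le_mul_of_nonneg_left ?_ (mul_nonneg h0 hX))
    apply Finset.sum_le_sum; intro u _
    apply Finset.sum_le_sum; intro v _
    have hPr := Pr_mono_p (off_inc (G := G) (Cg ω g) o u) h0 hq h1
    have hn := Pr_nonneg h0 hc.lt_one.le (fun ω' : Cf G => R (off (Cg ω g) ω') o u)
    rw [← mul_assoc, ← ind_and]
    refine mul_le_mul (ind_mono ?_) hPr hn (ind_nonneg _)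
    rintro ⟨a, b, c⟩
    exact ⟨a, ho, c⟩

/-- weight of a ghost set -/
def gw (γ : ℝ) (g : Finset V) : ℝ := (∏ _i ∈ g, γ) * ∏ _i ∈ Finset.univ \ g, (1 - γ)

lemma gw_nonneg {γ : ℝ} (h0 : 0 ≤ γ) (h1 : γ ≤ 1) (g : Finset V) : 0 ≤ gw γ g :=
  mul_nonneg (Finset.prod_nonneg fun _ _ => h0) (Finset.prod_nonneg fun _ _ => by linarith)

lemma gw_sum (γ : ℝ) (S : Finset V) :
    ∑ g : Finset V, gw γ g * ind (∀ a ∈ g, a ∉ S) = (1 - γ) ^ S.card := by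
  have h := Finset.prod_add (fun i : V => γ * ind (i ∉ S)) (fun _ => 1 - γ) Finset.univ
  have hl : ∏ i : V, (γ * ind (i ∉ S) + (1 - γ)) = (1 - γ) ^ S.card := by
    rw [← Finset.prod_const, ← Finset.prod_subset (Finset.subset_univ S)]
    · apply Finset.prod_congr rfl
      intro i hi
      rw [ind_false (by tauto)]; ring
    · intro i _ hi
      rw [ind_true hi]; ring
  rw [← hl, h, Finset.powerset_univ]
  apply Finset.sum_congr rfl
  intro g _
  unfold gw
  rw [Finset.prod_mul_distrib]
  have : ∏ i ∈ g, ind (i ∉ S) = ind (∀ a ∈ g, a ∉ S) := by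
    by_cases hh : ∀ a ∈ g, a ∉ S
    · rw [ind_true hh]
      exact Finset.prod_eq_one fun i hi => ind_true (hh i hi)
    · rw [ind_false hh]
      push Not at hh
      obtain ⟨a, ha, haS⟩ := hh
      exact Finset.prod_eq_zero ha (ind_false (by tauto))
  rw [this]; ring

lemma gw_Cg (γ : ℝ) (ω : Cf G) (o : V) :
    ∑ g : Finset V, gw γ g * ind (o ∉ Cg ω g) = (1 - γ) ^ (Cl ω o).card := by
  rw [← gw_sum]
  apply Finset.sum_congr rfl
  intro g _
  congr 1
  apply ind_congr
  rw [mem_Cg]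
  push Not
  simp only [mem_Cl]
  exact ⟨fun h a ha hR => h a ha (R_symm hR), fun h a ha hR => h a ha (R_symm hR)⟩

lemma ind_not (P : Prop) : ind P = 1 - ind (¬ P) := by
  by_cases h : P
  · rw [ind_true h, ind_false (by tauto)]; norm_num
  · rw [ind_false h, ind_true h]; norm_num

/-- Magnetization. -/
def Mg (G : SimpleGraph V) (γ q : ℝ) (o : V) : ℝ :=
  Ex q (fun ω : Cf G => 1 - (1 - γ) ^ (Cl ω o).card)

lemma ghost {Ω pc : ℝ} {o : V} (hc : Crit G Ω pc o) {q γ : ℝ} (hq : pc ≤ q) (h1 : q ≤ 1)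
    (hγ0 : 0 ≤ γ) (hγ1 : γ ≤ 1) :
    X G pc o * (1 - Mg G γ q o) ≤
      Ex q (fun ω : Cf G => (1 - γ) ^ (Cl ω o).card * ((Cl ω o).card : ℝ)) +
      pc * X G pc o * ((1 - q) * deriv (fun q => Mg G γ q o) q) := by
  have h0 := hc.pos.le
  have hq0 : 0 ≤ q := h0.trans hq
  have hX := X_nonneg (G := G) h0 hc.lt_one.le o
  have hP := PIV (G := G) hq0 h1 (fun ω => 1 - (1 - γ) ^ (Cl ω o).card)
    (fun u v ω => ∑ g : Finset V, gw γ g * kk o g u v ω) (by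
      intro u v h ω
      rw [← Finset.sum_add_distrib]
      have hs : (if ω (ed h) then (0 : ℝ) else (1 - (1 - γ) ^ (Cl (upd ω (ed h) true) o).card) -
          (1 - (1 - γ) ^ (Cl ω o).card)) = ∑ g : Finset V, gw γ g * (if ω (ed h) then 0 else
      ind (o ∈ Cg (upd ω (ed h) true) g) - ind (o ∈ Cg ω g)) := by
        split_ifs
        · simp
        · rw [← gw_Cg γ ω o, ← gw_Cg γ (upd ω (ed h) true) o, sub_sub_sub_cancel_left,
            ← Finset.sum_sub_distrib]
          apply Finset.sum_congr rfl
          intro g _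
          rw [ind_not (o ∈ Cg ω g), ind_not (o ∈ Cg (upd ω (ed h) true) g)]
          ring
      rw [hs]
      apply Finset.sum_le_sum
      intro g _
      rw [← mul_add]
      exact mul_le_mul_of_nonneg_left (kk_pair h ω) (gw_nonneg hγ0 hγ1 g))
  have hsum := Finset.sum_le_sum (s := (Finset.univ : Finset (Finset V))) fun g _ =>
    mul_le_mul_of_nonneg_left (ghost_g hc hq h1 g) (gw_nonneg hγ0 hγ1 g)
  have e1 : ∑ g : Finset V, gw γ g * (X G pc o * Ex q (fun ω : Cf G => ind (o ∉ Cg ω g))) =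
      X G pc o * (1 - Mg G γ q o) := by
    have : 1 - Mg G γ q o = Ex q (fun ω : Cf G => ∑ g, gw γ g * ind (o ∉ Cg ω g)) := by
      simp only [gw_Cg, Mg, Ex_sub, Ex_one]; ring
    rw [this, Ex_sum, Finset.mul_sum]
    apply Finset.sum_congr rfl
    intro g _
    rw [Ex_mul_left]; ring
  have e2 : ∑ g : Finset V, gw γ g *
      Ex q (fun ω : Cf G => ind (o ∉ Cg ω g) * ((Cl ω o).card : ℝ)) =
      Ex q (fun ω : Cf G => (1 - γ) ^ (Cl ω o).card * ((Cl ω o).card : ℝ)) := by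
    simp only [← gw_Cg, ← Ex_mul_left, ← Ex_sum, Finset.sum_mul, mul_assoc]
  have e3 : ∑ g : Finset V, gw γ g *
      (pc * X G pc o * ∑ u, ∑ v, ind (G.Adj u v) * Ex q (kk (G := G) o g u v)) =
      pc * X G pc o * ∑ u, ∑ v, ind (G.Adj u v) *
        Ex q (fun ω : Cf G => ∑ g : Finset V, gw γ g * kk o g u v ω) := by
    simp only [Ex_sum, Ex_mul_left, Finset.mul_sum]
    rw [Finset.sum_comm]
    apply Finset.sum_congr rfl; intro u _
    rw [Finset.sum_comm]
    apply Finset.sum_congr rfl; intro v _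
    apply Finset.sum_congr rfl; intro g _
    ring
  simp only [mul_add, Finset.sum_add_distrib] at hsum
  rw [e1, e2, e3] at hsum
  refine hsum.trans ?_
  have := mul_le_mul_of_nonneg_left hP (mul_nonneg h0 hX)
  unfold Mg
  linarith

lemma pow_bound {γ : ℝ} (hγ0 : 0 < γ) (hγ1 : γ ≤ 1) (n : ℕ) :
    (1 - γ) ^ n * (n : ℝ) ≤ min (n : ℝ) (1 / γ) := by
  have h0 : 0 ≤ 1 - γ := by linarith
  have hn : (0 : ℝ) ≤ n := Nat.cast_nonneg n
  apply le_min
  · have : (1 - γ) ^ n ≤ 1 := pow_le_one₀ h0 (by linarith)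
    nlinarith
  · rw [le_div_iff₀ hγ0]
    have hb := one_add_mul_le_pow (a := γ) (by linarith) n
    have hp : (1 - γ) ^ n * (1 + γ) ^ n ≤ 1 := by
      rw [← mul_pow]
      exact pow_le_one₀ (by nlinarith) (by nlinarith)
    have hp0 : 0 ≤ (1 - γ) ^ n := pow_nonneg h0 n
    nlinarith

lemma pow_bound2 {γ : ℝ} (hγ0 : 0 ≤ γ) (hγ1 : γ ≤ 1) {N : ℝ} (hN : 0 ≤ N) (n : ℕ) :
    1 - (1 - γ) ^ n ≤ ind (N ≤ n) + γ * min (n : ℝ) N := by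
  have h0 : 0 ≤ 1 - γ := by linarith
  by_cases h : N ≤ n
  · rw [ind_true h, min_eq_right h]
    have := pow_nonneg h0 n
    nlinarith
  · rw [ind_false h]
    push Not at h
    rw [min_eq_left h.le]
    have hb := one_add_mul_le_pow (a := -γ) (by linarith) n
    rw [← sub_eq_add_neg] at hb
    linarith

lemma Cl_card_monotone (o : V) {ω ω' : Cf G} (h : ω ≤ ω') : (Cl ω o).card ≤ (Cl ω' o).card := by
  apply Finset.card_le_card
  intro z hz
  rw [mem_Cl] at hz ⊢
  exact R_mono (Le_of_le h) hz

lemma F_mono_p {n p q : ℝ} (o : V) (h0 : 0 ≤ p) (h : p ≤ q) (h1 : q ≤ 1) :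
    F G p n o ≤ F G q n o := by
  apply Ex_mono_p _ h0 h h1
  intro ω ω' hω
  apply min_le_min _ le_rfl
  exact_mod_cast Cl_card_monotone o hω

lemma Mg_mono_p {γ p q : ℝ} (hγ0 : 0 ≤ γ) (hγ1 : γ ≤ 1) (o : V) (h0 : 0 ≤ p) (h : p ≤ q)
    (h1 : q ≤ 1) : Mg G γ p o ≤ Mg G γ q o := by
  apply Ex_mono_p _ h0 h h1
  intro ω ω' hω
  have := pow_le_pow_of_le_one (show 0 ≤ 1 - γ by linarith) (by linarith) (Cl_card_monotone o hω)
  simp only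
  linarith

lemma Mg_lower {Ω pc : ℝ} {o : V} (hc : Crit G Ω pc o) {ε γ : ℝ} (hε : 0 < ε) (hε1 : ε ≤ 1)
    (hγ0 : 0 < γ) (hγ1 : γ ≤ 1) (hF : F G (pc + ε / Ω) (1 / γ) o ≤ X G pc o / 4) :
    ε / 4 ≤ Mg G γ (pc + ε / Ω) o := by
  have hΩ := hc.Omega_pos
  have hp := hc.p_half hε1
  have hpc := hc.pos
  have hX8 := hc.chi
  have hup := hc.upper
  have hpos : 0 < ε / Ω := by positivity
  set p := pc + ε / Ω with hpdef
  by_contra hcon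
  push Not at hcon
  have hd : ∀ q, HasDerivAt (fun q => Mg G γ q o) (deriv (fun q => Mg G γ q o) q) q := fun q =>
    (differentiable_Ex (fun ω : Cf G => 1 - (1 - γ) ^ (Cl ω o).card) q).hasDerivAt
  have hder : ∀ q ∈ Set.Icc pc p, Ω / 4 ≤ deriv (fun q => Mg G γ q o) q := by
    rintro q ⟨hq1, hq2⟩
    have hM := Mg_mono_p (G := G) hγ0.le hγ1 o (hpc.le.trans hq1) hq2 (by linarith)
    have hg := ghost hc hq1 (by linarith) hγ0.le hγ1
    have hFq : Ex q (fun ω : Cf G => (1 - γ) ^ (Cl ω o).card * ((Cl ω o).card : ℝ)) ≤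
        X G pc o / 4 := by
      refine le_trans ?_ ((F_mono_p o (hpc.le.trans hq1) hq2 (by linarith)).trans hF)
      exact Ex_mono (hpc.le.trans hq1) (by linarith) fun ω => pow_bound hγ0 hγ1 _
    set D := deriv (fun q => Mg G γ q o) q
    have h2 : 1 / 2 ≤ pc * ((1 - q) * D) := by
      by_contra hlt
      push Not at hlt
      nlinarith
    have hDpos : 0 < D := by
      by_contra hD
      push Not at hD
      have : pc * ((1 - q) * D) ≤ 0 :=
        mul_nonpos_of_nonneg_of_nonpos hpc.le
          (mul_nonpos_of_nonneg_of_nonpos (by linarith) hD)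
      linarith
    have h3 : 1 / 2 ≤ pc * D := by
      have : pc * ((1 - q) * D) ≤ pc * D := by
        apply mul_le_mul_of_nonneg_left _ hpc.le
        nlinarith
      linarith
    nlinarith
  have hmono : MonotoneOn (fun q => Mg G γ q o - Ω / 4 * q) (Set.Icc pc p) := by
    have hdd : ∀ q, HasDerivAt (fun q => Mg G γ q o - Ω / 4 * q)
        (deriv (fun q => Mg G γ q o) q - Ω / 4) q := by
      intro q
      have h := (hd q).fun_sub ((hasDerivAt_id q).const_mul (Ω / 4))
      simpa using h
    apply monotoneOn_of_deriv_nonneg (convex_Icc pc p)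
    · exact fun q _ => (hdd q).continuousAt.continuousWithinAt
    · exact fun q _ => (hdd q).differentiableAt.differentiableWithinAt
    · intro q hq'
      rw [(hdd q).deriv]
      linarith [hder q (interior_subset hq')]
  have hle : pc ≤ p := by rw [hpdef]; linarith
  have h := hmono ⟨le_rfl, hle⟩ ⟨hle, le_rfl⟩ hle
  simp only at h
  have hM0 : 0 ≤ Mg G γ pc o := Ex_nonneg hpc.le hc.lt_one.le fun ω => by
    have := pow_le_one₀ (n := (Cl ω o).card) (show 0 ≤ 1 - γ by linarith) (by linarith)
    linarith
  have he : Ω / 4 * p - Ω / 4 * pc = ε / 4 := by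
    rw [hpdef]; field_simp; ring
  linarith

lemma theta_lower {Ω pc : ℝ} {o : V} (hc : Crit G Ω pc o) {ε N : ℝ} (hε : 0 < ε) (hε1 : ε ≤ 1)
    (hN1 : 1 ≤ N) (hN : 1 / (144 * ε ^ 2) ≤ N)
    (hF : F G (pc + ε / Ω) (6912 * N) o ≤ X G pc o / 4) :
    ε / 12 ≤ Pr (pc + ε / Ω) (fun ω : Cf G => N ≤ ((Cl ω o).card : ℝ)) := by
  have hp := hc.p_half hε1
  have hΩ := hc.Omega_pos
  have hpp : 0 < pc + ε / Ω := add_pos hc.pos (by positivity)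
  set γ := 1 / (6912 * N) with hγ
  have hγ0 : 0 < γ := by positivity
  have hγ1 : γ ≤ 1 := by
    rw [hγ, div_le_one (by positivity)]; linarith
  have hM := Mg_lower hc hε hε1 hγ0 hγ1 (by rw [hγ, one_div_one_div]; exact hF)
  have hFb := hc.F_bound hε hε1 hN
  have h : Mg G γ (pc + ε / Ω) o ≤ Pr (pc + ε / Ω) (fun ω : Cf G => N ≤ ((Cl ω o).card : ℝ)) +
      γ * F G (pc + ε / Ω) N o := by
    unfold Pr F
    rw [← Ex_mul_left, ← Ex_add]
    exact Ex_mono hpp.le (by linarith) fun ω => pow_bound2 hγ0.le hγ1 (by linarith) _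
  have h2 : γ * F G (pc + ε / Ω) N o ≤ ε / 12 := by
    calc _ ≤ γ * (576 * ε * N) := by gcongr
      _ = ε / 12 := by rw [hγ]; field_simp; norm_num
  linarith

end Lower

end PercAux

namespace PercAux

section Var

variable {V : Type} [Fintype V] [DecidableEq V] {G : SimpleGraph V}

lemma cross_exists {T : Finset V} {y : V} (hy : y ∉ T) (ω : Cf G)
    (hno : ¬ ∃ b a, ∃ h : G.Adj b a, a ∈ T ∧ ω (ed h) = true ∧ R (off T ω) y b) :
    Cl ω y = Cl (off T ω) y := by
  ext z
  rw [mem_Cl, mem_Cl]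
  constructor
  · intro h
    apply R_ind (P := fun z => R (off T ω) y z) (R_refl _ _) _ z h
    intro z w _ hz hadj ho
    refine R_trans hz (R_edge hadj ?_)
    rw [off_true, touch_mk]
    refine ⟨ho, ?_⟩
    rintro (hzT | hwT)
    · exact off_notMem hy hz hzT
    · exact hno ⟨z, w, hadj, hwT, ho, hz⟩
  · exact R_mono (off_le T ω)

/-- indicator that the edge `b a` exists and is open -/
def op (b a : V) (ω : Cf G) : ℝ := if h : G.Adj b a then ind (ω (ed h) = true) else 0

lemma op_nonneg (b a : V) (ω : Cf G) : 0 ≤ op b a ω := by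
  unfold op; split_ifs
  · exact ind_nonneg _
  · exact le_rfl

lemma op_Ex (p : ℝ) (b a : V) : Ex p (fun ω : Cf G => op b a ω) = p * ind (G.Adj b a) := by
  unfold op
  by_cases h : G.Adj b a
  · simp only [h, dif_pos]
    rw [ind_true trivial, mul_one]
    exact Pr_open p (ed h)
  · simp only [h, dif_neg, not_false_eq_true, Ex_const]
    rw [ind_false (by simp), mul_zero]

lemma off_congr {T : Finset V} {ω ω' : Cf G} (h : ∀ e, ¬ touch T e → ω e = ω' e) :
    off T ω = off T ω' := by
  ext e
  unfold off
  by_cases ht : touch T e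
  · simp [ht]
  · simp [ht, h e ht]

lemma op_indep (p : ℝ) {T : Finset V} {a : V} (ha : a ∈ T) (b : V) (f : Cf G → ℝ) :
    Ex p (fun ω : Cf G => op b a ω * f (off T ω)) =
      p * ind (G.Adj b a) * Ex p (fun ω : Cf G => f (off T ω)) := by
  rw [← op_Ex]
  apply Ex_indep p (fun e => touch T e)
  · intro ω ω' h
    unfold op
    split_ifs with hadj
    · rw [h (ed hadj) ((touch_mk hadj).2 (Or.inr ha))]
    · rfl
  · intro ω ω' h
    rw [off_congr h]

lemma cross_ind (N : ℝ) {T : Finset V} {y : V} (hy : y ∉ T) (ω : Cf G) :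
    ind (N ≤ ((Cl ω y).card : ℝ)) ≤ ind (N ≤ ((Cl (off T ω) y).card : ℝ)) +
      ∑ b, ∑ a ∈ T, op b a ω *
        ind (R (off T ω) y b ∧ ((Cl (off T ω) y).card : ℝ) < N) := by
  have hnn : ∀ b a, 0 ≤ op b a ω *
        ind (R (off T ω) y b ∧ ((Cl (off T ω) y).card : ℝ) < N) := fun b a =>
    mul_nonneg (op_nonneg _ _ _) (ind_nonneg _)
  have hs : 0 ≤ ∑ b, ∑ a ∈ T, op b a ω *
        ind (R (off T ω) y b ∧ ((Cl (off T ω) y).card : ℝ) < N) :=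
    Finset.sum_nonneg fun b _ => Finset.sum_nonneg fun a _ => hnn b a
  by_cases h1 : N ≤ ((Cl (off T ω) y).card : ℝ)
  · rw [ind_true h1]
    linarith [ind_le_one (N ≤ ((Cl ω y).card : ℝ))]
  · by_cases hex : ∃ b a, ∃ h : G.Adj b a, a ∈ T ∧ ω (ed h) = true ∧ R (off T ω) y b
    · obtain ⟨b, a, h, ha, ho, hR⟩ := hex
      have e1 := Finset.single_le_sum (f := fun b => ∑ a ∈ T, op b a ω *
        ind (R (off T ω) y b ∧ ((Cl (off T ω) y).card : ℝ) < N))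
        (fun b _ => Finset.sum_nonneg fun a _ => hnn b a) (Finset.mem_univ b)
      have e2 := Finset.single_le_sum (f := fun a => op b a ω *
        ind (R (off T ω) y b ∧ ((Cl (off T ω) y).card : ℝ) < N))
        (fun a _ => hnn b a) ha
      have e3 : op b a ω * ind (R (off T ω) y b ∧ ((Cl (off T ω) y).card : ℝ) < N) = 1 := by
        rw [ind_true ⟨hR, not_le.1 h1⟩, mul_one]
        unfold op
        rw [dif_pos h, ind_true ho]
      linarith [ind_le_one (N ≤ ((Cl ω y).card : ℝ)),
        ind_nonneg (N ≤ ((Cl (off T ω) y).card : ℝ))]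
    · rw [cross_exists hy ω hex]
      linarith

lemma Cl_congr {ω : Cf G} {x y : V} (h : R ω x y) : Cl ω x = Cl ω y := by
  ext z
  rw [mem_Cl, mem_Cl]
  exact ⟨fun hz => R_trans (R_symm h) hz, fun hz => R_trans h hz⟩

lemma cross_sum {p : ℝ} (h0 : 0 ≤ p) (h1 : p ≤ 1) (hT : Percolation.IsTransitive G) {Ω : ℝ}
    (hΩ : ∀ u, ∑ v, ind (G.Adj u v) = Ω) {N : ℝ} (hN : 0 ≤ N) (T : Finset V) (o : V) :
    ∑ y, ind (y ∉ T) * (Pr p (fun ω : Cf G => N ≤ ((Cl ω y).card : ℝ)) -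
      Pr p (fun ω : Cf G => N ≤ ((Cl (off T ω) y).card : ℝ))) ≤
      T.card * Ω * p * F G p N o := by
  have step1 : ∀ y, ind (y ∉ T) * (Pr p (fun ω : Cf G => N ≤ ((Cl ω y).card : ℝ)) -
      Pr p (fun ω : Cf G => N ≤ ((Cl (off T ω) y).card : ℝ))) ≤
      ∑ b, ∑ a ∈ T, p * ind (G.Adj b a) *
        Ex p (fun ω : Cf G => ind (R (off T ω) y b ∧ ((Cl (off T ω) y).card : ℝ) < N)) := by
    intro y
    by_cases hy : y ∈ T
    · rw [ind_false (by tauto), zero_mul]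
      exact Finset.sum_nonneg fun b _ => Finset.sum_nonneg fun a _ =>
        mul_nonneg (mul_nonneg h0 (ind_nonneg _)) (Ex_nonneg h0 h1 fun _ => ind_nonneg _)
    · rw [ind_true hy, one_mul, sub_le_iff_le_add']
      have : ∑ b, ∑ a ∈ T, p * ind (G.Adj b a) *
        Ex p (fun ω : Cf G => ind (R (off T ω) y b ∧ ((Cl (off T ω) y).card : ℝ) < N)) =
        Ex p (fun ω : Cf G => ∑ b, ∑ a ∈ T, op b a ω *
        ind (R (off T ω) y b ∧ ((Cl (off T ω) y).card : ℝ) < N)) := by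
        rw [Ex_sum]
        apply Finset.sum_congr rfl; intro b _
        rw [Ex_sum]
        apply Finset.sum_congr rfl; intro a ha
        exact (op_indep p ha b (fun ω => ind (R ω y b ∧ ((Cl ω y).card : ℝ) < N))).symm
      rw [this]
      unfold Pr
      rw [← Ex_add]
      exact Ex_mono h0 h1 fun ω => cross_ind N hy ω
  have step2 : ∀ b, ∑ y, Ex p (fun ω : Cf G =>
      ind (R (off T ω) y b ∧ ((Cl (off T ω) y).card : ℝ) < N)) ≤ F G p N o := by
    intro b
    have hFb : F G p N o = F G p N b := Ex_card_aut p hT (fun n => min (n : ℝ) N) o b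
    rw [hFb, ← Ex_sum]
    apply Ex_mono h0 h1
    intro ω
    have hle : ((Cl (off T ω) b).card : ℝ) ≤ (Cl ω b).card := by
      exact_mod_cast Finset.card_le_card (Cl_mono (off_le T ω) b)
    have e : ∀ y, ind (R (off T ω) y b ∧ ((Cl (off T ω) y).card : ℝ) < N) =
        ind (R (off T ω) b y) * ind (((Cl (off T ω) b).card : ℝ) < N) := by
      intro y
      rw [← ind_and]
      apply ind_congr
      constructor
      · rintro ⟨hR, hl⟩
        rw [Cl_congr hR] at hl
        exact ⟨R_symm hR, hl⟩
      · rintro ⟨hR, hl⟩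
        rw [Cl_congr hR] at hl
        exact ⟨R_symm hR, hl⟩
    simp only [e]
    rw [← Finset.sum_mul, ← card_Cl]
    by_cases hl : ((Cl (off T ω) b).card : ℝ) < N
    · rw [ind_true hl, mul_one]
      exact le_min hle hl.le
    · rw [ind_false hl, mul_zero]
      exact le_min (Nat.cast_nonneg _) hN
  have hF := F_nonneg (G := G) h0 h1 hN o
  calc _ ≤ ∑ y, ∑ b, ∑ a ∈ T, p * ind (G.Adj b a) *
        Ex p (fun ω : Cf G => ind (R (off T ω) y b ∧ ((Cl (off T ω) y).card : ℝ) < N)) :=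
        Finset.sum_le_sum fun y _ => step1 y
    _ = ∑ b, ∑ a ∈ T, p * ind (G.Adj b a) * ∑ y,
        Ex p (fun ω : Cf G => ind (R (off T ω) y b ∧ ((Cl (off T ω) y).card : ℝ) < N)) := by
        rw [Finset.sum_comm]
        apply Finset.sum_congr rfl; intro b _
        rw [Finset.sum_comm]
        apply Finset.sum_congr rfl; intro a _
        rw [Finset.mul_sum]
    _ ≤ ∑ b, ∑ a ∈ T, p * ind (G.Adj b a) * F G p N o := by
        apply Finset.sum_le_sum; intro b _
        apply Finset.sum_le_sum; intro a _
        exact mul_le_mul_of_nonneg_left (step2 b) (mul_nonneg h0 (ind_nonneg _))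
    _ = ∑ a ∈ T, Ω * (p * F G p N o) := by
        rw [Finset.sum_comm]
        apply Finset.sum_congr rfl; intro a _
        rw [← hΩ a, Finset.sum_mul]
        apply Finset.sum_congr rfl; intro b _
        rw [ind_congr (G.adj_comm a b)]
        ring
    _ = _ := by
        rw [Finset.sum_const, nsmul_eq_mul]; ring

/-- covariance summed over one vertex -/
lemma cov_row {p : ℝ} (h0 : 0 ≤ p) (h1 : p ≤ 1) (hT : Percolation.IsTransitive G) {Ω : ℝ}
    (hΩ : ∀ u, ∑ v, ind (G.Adj u v) = Ω) (hΩ0 : 0 ≤ Ω) {N : ℝ} (hN : 0 ≤ N) (x o : V) :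
    ∑ y, (Pr p (fun ω : Cf G => ((Cl ω x).card : ℝ) < N) *
        Pr p (fun ω : Cf G => N ≤ ((Cl ω y).card : ℝ)) -
      Ex p (fun ω : Cf G => ind (((Cl ω x).card : ℝ) < N) * ind (N ≤ ((Cl ω y).card : ℝ)))) ≤
      F G p N o * (1 + Ω * p * F G p N o) := by
  have hF := F_nonneg (G := G) h0 h1 hN o
  have hrow : ∀ y, Pr p (fun ω : Cf G => ((Cl ω x).card : ℝ) < N) *
        Pr p (fun ω : Cf G => N ≤ ((Cl ω y).card : ℝ)) -
      Ex p (fun ω : Cf G => ind (((Cl ω x).card : ℝ) < N) * ind (N ≤ ((Cl ω y).card : ℝ))) ≤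
      Ex p (fun ω : Cf G => ind (((Cl ω x).card : ℝ) < N) * (ind (y ∈ Cl ω x) +
        ind (y ∉ Cl ω x) * (Pr p (fun ω' : Cf G => N ≤ ((Cl ω' y).card : ℝ)) -
      Pr p (fun ω' : Cf G => N ≤ ((Cl (off (Cl ω x) ω') y).card : ℝ))))) := by
    intro y
    have hfac := FAC (G := G) p {x} (fun T ω => ind ((T.card : ℝ) < N) * (ind (y ∉ T) *
      ind (N ≤ ((Cl ω y).card : ℝ))))
    simp only [Ex_mul_left, Cg_single] at hfac
    have hlow : Ex p (fun ω : Cf G => ind (((Cl ω x).card : ℝ) < N) * (ind (y ∉ Cl ω x) *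
        Pr p (fun ω' : Cf G => N ≤ ((Cl (off (Cl ω x) ω') y).card : ℝ)))) ≤
        Ex p (fun ω : Cf G => ind (((Cl ω x).card : ℝ) < N) * ind (N ≤ ((Cl ω y).card : ℝ))) := by
      unfold Pr
      rw [← hfac]
      apply Ex_mono h0 h1
      intro ω
      apply mul_le_mul_of_nonneg_left _ (ind_nonneg _)
      by_cases hy : y ∈ Cl ω x
      · rw [ind_false (by tauto), zero_mul]; exact ind_nonneg _
      · rw [ind_true hy, one_mul]
        apply ind_mono
        intro h
        refine h.trans ?_
        exact_mod_cast Finset.card_le_card (Cl_mono (off_le _ ω) y)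
    have hup : Pr p (fun ω : Cf G => ((Cl ω x).card : ℝ) < N) *
        Pr p (fun ω : Cf G => N ≤ ((Cl ω y).card : ℝ)) =
        Ex p (fun ω : Cf G => ind (((Cl ω x).card : ℝ) < N) *
          Pr p (fun ω' : Cf G => N ≤ ((Cl ω' y).card : ℝ))) := by
      rw [Ex_mul_right]; rfl
    rw [hup]
    refine (sub_le_sub_left hlow _).trans ?_
    rw [← Ex_sub]
    apply Ex_mono h0 h1
    intro ω
    rw [← mul_sub]
    apply mul_le_mul_of_nonneg_left _ (ind_nonneg _)
    by_cases hy : y ∈ Cl ω x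
    · rw [ind_true hy, ind_false (show ¬ y ∉ Cl ω x by tauto)]
      have := Pr_le_one h0 h1 (fun ω' : Cf G => N ≤ ((Cl ω' y).card : ℝ))
      linarith
    · rw [ind_true hy, ind_false hy]; linarith
  refine (Finset.sum_le_sum fun y _ => hrow y).trans ?_
  rw [← Ex_sum]
  have hFx : F G p N o = F G p N x := Ex_card_aut p hT (fun n => min (n : ℝ) N) o x
  have : F G p N o * (1 + Ω * p * F G p N o) =
      Ex p (fun ω : Cf G => min ((Cl ω x).card : ℝ) N * (1 + Ω * p * F G p N o)) := by
    rw [Ex_mul_right]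
    conv_lhs => rw [hFx]
    conv_rhs => rw [hFx]
    rfl
  rw [this]
  apply Ex_mono h0 h1
  intro ω
  rw [← Finset.mul_sum, Finset.sum_add_distrib, sum_ind_mem]
  have hc := cross_sum h0 h1 hT hΩ hN (Cl ω x) o
  by_cases hl : ((Cl ω x).card : ℝ) < N
  · rw [ind_true hl, one_mul, min_eq_left hl.le]
    linarith
  · rw [ind_false hl, zero_mul]
    have : 0 ≤ min ((Cl ω x).card : ℝ) N := le_min (Nat.cast_nonneg _) hN
    positivity

/-- number of vertices in large clusters -/
def Zn (N : ℝ) (ω : Cf G) : ℝ := ∑ x, ind (N ≤ ((Cl ω x).card : ℝ))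

lemma Zn_mean (p : ℝ) (hT : Percolation.IsTransitive G) (N : ℝ) (o : V) :
    Ex p (fun ω : Cf G => Zn N ω) =
      Pr p (fun ω : Cf G => N ≤ ((Cl ω o).card : ℝ)) * Fintype.card V := by
  unfold Zn
  rw [Ex_sum, Finset.sum_congr rfl (fun x _ => Ex_card_aut p hT (fun n => ind (N ≤ (n : ℝ))) x o)]
  rw [Finset.sum_const, nsmul_eq_mul, mul_comm]
  rfl

lemma Zn_var {p : ℝ} (h0 : 0 ≤ p) (h1 : p ≤ 1) (hT : Percolation.IsTransitive G) {Ω : ℝ}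
    (hΩ : ∀ u, ∑ v, ind (G.Adj u v) = Ω) (hΩ0 : 0 ≤ Ω) {N : ℝ} (hN : 0 ≤ N) (o : V) :
    Ex p (fun ω : Cf G => Zn N ω * Zn N ω) -
      Ex p (fun ω : Cf G => Zn N ω) * Ex p (fun ω : Cf G => Zn N ω) ≤
      Fintype.card V * (F G p N o * (1 + Ω * p * F G p N o)) := by
  have hl : ∀ (ω : Cf G) x, ind (((Cl ω x).card : ℝ) < N) = 1 - ind (N ≤ ((Cl ω x).card : ℝ)) := by
    intro ω x
    rw [ind_not]
    congr 1
    apply ind_congr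
    exact not_lt
  have hlP : ∀ x, Pr p (fun ω : Cf G => ((Cl ω x).card : ℝ) < N) =
      1 - Pr p (fun ω : Cf G => N ≤ ((Cl ω x).card : ℝ)) := by
    intro x
    unfold Pr
    simp only [hl, Ex_sub, Ex_one]
  have e : Ex p (fun ω : Cf G => Zn N ω * Zn N ω) -
      Ex p (fun ω : Cf G => Zn N ω) * Ex p (fun ω : Cf G => Zn N ω) =
      ∑ x, ∑ y, (Pr p (fun ω : Cf G => ((Cl ω x).card : ℝ) < N) *
        Pr p (fun ω : Cf G => N ≤ ((Cl ω y).card : ℝ)) -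
      Ex p (fun ω : Cf G => ind (((Cl ω x).card : ℝ) < N) * ind (N ≤ ((Cl ω y).card : ℝ)))) := by
    unfold Zn
    simp only [Finset.sum_mul_sum, Ex_sum]
    rw [← Finset.sum_sub_distrib]
    apply Finset.sum_congr rfl; intro x _
    rw [← Finset.sum_sub_distrib]
    apply Finset.sum_congr rfl; intro y _
    rw [hlP]
    simp only [hl, sub_mul, one_mul, Ex_sub]
    unfold Pr
    ring
  rw [e]
  refine (Finset.sum_le_sum fun x _ => cov_row h0 h1 hT hΩ hΩ0 hN x o).trans ?_
  rw [Finset.sum_const, nsmul_eq_mul]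
  rfl

lemma max_le_Zn (o : V) {N : ℝ} (ω : Cf G) (h : N ≤ (Percolation.maxCluster G ω : ℝ)) :
    (Percolation.maxCluster G ω : ℝ) ≤ Zn N ω := by
  obtain ⟨x, -, hx⟩ := Finset.exists_mem_eq_sup Finset.univ ⟨o, Finset.mem_univ o⟩
    (fun x => (Percolation.cluster G ω x).card)
  have hx' : Percolation.maxCluster G ω = (Cl ω x).card := hx
  rw [hx'] at h ⊢
  rw [card_Cl]
  unfold Zn
  apply Finset.sum_le_sum
  intro y _
  apply ind_mono
  intro hR
  rw [← Cl_congr hR]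
  exact h

lemma cheb {p : ℝ} (h0 : 0 ≤ p) (h1 : p ≤ 1) (f : Cf G → ℝ) {s v : ℝ} (hs : 0 < s)
    (hv : Ex p (fun ω => f ω * f ω) - Ex p f * Ex p f ≤ v) :
    1 - v / s ^ 2 ≤ Pr p (fun ω => f ω ≤ Ex p f + s) := by
  set m := Ex p f with hm
  have hE : Ex p (fun ω => (f ω - m) ^ 2) = Ex p (fun ω => f ω * f ω) - m * m := by
    have : ∀ ω, (f ω - m) ^ 2 = (f ω * f ω - 2 * m * f ω) + m ^ 2 := fun ω => by ring
    simp only [this, Ex_add, Ex_sub, Ex_mul_left, Ex_const, ← hm]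
    ring
  have hle : Ex p (fun ω => 1 - (f ω - m) ^ 2 / s ^ 2) ≤ Pr p (fun ω => f ω ≤ m + s) := by
    apply Ex_mono h0 h1
    intro ω
    by_cases h : f ω ≤ m + s
    · rw [ind_true h]
      have : 0 ≤ (f ω - m) ^ 2 / s ^ 2 := by positivity
      linarith
    · rw [ind_false h, sub_nonpos, le_div_iff₀ (by positivity), one_mul]
      push Not at h
      nlinarith
  refine le_trans ?_ hle
  simp only [div_eq_mul_inv, Ex_sub, Ex_one, Ex_mul_right, hE]
  gcongr

lemma upper_main {Ω pc : ℝ} {o : V} (hc : Crit G Ω pc o) {ε N κ : ℝ} (hε : 0 < ε) (hε1 : ε ≤ 1)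
    (hN1 : 1 ≤ N) (hκ : 0 < κ)
    (hNθ : N ≤ Pr (pc + ε / Ω) (fun ω : Cf G => N ≤ ((Cl ω o).card : ℝ)) * Fintype.card V) :
    1 - 4 * Fintype.card V * F G (pc + ε / Ω) N o ^ 2 /
      (κ * (Pr (pc + ε / Ω) (fun ω : Cf G => N ≤ ((Cl ω o).card : ℝ)) * Fintype.card V)) ^ 2 ≤
    Pr (pc + ε / Ω) (fun ω : Cf G => (Percolation.maxCluster G ω : ℝ) ≤
      (1 + κ) * Pr (pc + ε / Ω) (fun ω : Cf G => N ≤ ((Cl ω o).card : ℝ)) * Fintype.card V) := by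
  have hp := hc.p_half hε1
  have hΩ := hc.Omega_pos
  have hpp : 0 < pc + ε / Ω := add_pos hc.pos (by positivity)
  have hup := hc.upper
  have hΩp : Ω * (pc + ε / Ω) ≤ 3 := by
    have : Ω * (pc + ε / Ω) = Ω * pc + ε := by field_simp
    linarith
  set p := pc + ε / Ω
  set θ := Pr p (fun ω : Cf G => N ≤ ((Cl ω o).card : ℝ)) with hθ
  have hp1 : p ≤ 1 := by linarith
  have hF1 : 1 ≤ F G p N o := by
    rw [← Ex_one (ι := G.edgeSet) p]
    apply Ex_mono hpp.le hp1
    intro ω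
    apply le_min _ hN1
    exact_mod_cast Finset.card_pos.2 ⟨o, mem_Cl.2 (R_refl _ _)⟩
  have hvar := Zn_var (G := G) hpp.le hp1 hc.trans hc.deg hΩ.le (by linarith : (0 : ℝ) ≤ N) o
  have hm := Zn_mean (G := G) p hc.trans N o
  rw [← hθ] at hm
  have hv4 : Fintype.card V * (F G p N o * (1 + Ω * p * F G p N o)) ≤
      4 * Fintype.card V * F G p N o ^ 2 := by
    have : F G p N o * (1 + Ω * p * F G p N o) ≤ 4 * F G p N o ^ 2 := by
      nlinarith [mul_le_mul_of_nonneg_right hΩp (sq_nonneg (F G p N o))]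
    have hV : (0 : ℝ) ≤ Fintype.card V := Nat.cast_nonneg _
    nlinarith
  have hmpos : 0 < θ * Fintype.card V := by linarith
  have hch := cheb hpp.le hp1 (fun ω : Cf G => Zn N ω) (s := κ * (θ * Fintype.card V))
    (mul_pos hκ hmpos) (hvar.trans hv4)
  refine hch.trans ?_
  apply Pr_mono hpp.le hp1
  intro ω hω
  rw [hm] at hω
  rcases le_total N (Percolation.maxCluster G ω : ℝ) with h | h
  · have := max_le_Zn o ω h
    nlinarith
  · have := mul_pos hκ hmpos
    nlinarith

end Var

end PercAux

namespace PercAux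

lemma num_id {v ε α η : ℝ} (hv : 0 < v) (hε : 0 < ε) (hα1 : α < 1)
    (hη : η = (1 : ℝ) / 3 * (3 - 2 * α) / (5 - 2 * α)) :
    ((ε ^ 2)⁻¹ * (ε * v ^ ((1 : ℝ) / 3)) ^ α) ^ 2 * (ε * v ^ η) ^ (5 - 2 * α) = ε * v := by
  have h5 : 5 - 2 * α ≠ 0 := by intro h; linarith
  set w := v ^ ((1 : ℝ) / 3) with hw
  have hw0 : 0 < w := Real.rpow_pos_of_pos hv _
  have hw3 : w ^ 3 = v := by
    rw [hw, ← Real.rpow_mul_natCast hv.le]; norm_num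
  have e1 : (v ^ η) ^ (5 - 2 * α) = w ^ (3 - 2 * α) := by
    rw [hw, ← Real.rpow_mul hv.le, ← Real.rpow_mul hv.le]
    congr 1
    rw [hη]; field_simp
  have e2 : ε ^ (5 - 2 * α) = ε ^ 5 / (ε ^ α) ^ 2 := by
    rw [Real.rpow_sub hε, ← Real.rpow_mul_natCast hε.le, ← Real.rpow_natCast]
    norm_num [mul_comm]
  have e3 : w ^ (3 - 2 * α) = w ^ 3 / (w ^ α) ^ 2 := by
    rw [Real.rpow_sub hw0, ← Real.rpow_mul_natCast hw0.le, ← Real.rpow_natCast]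
    norm_num [mul_comm]
  have hvη : 0 < v ^ η := Real.rpow_pos_of_pos hv _
  rw [Real.mul_rpow hε.le hvη.le, e1, e2, e3, Real.mul_rpow hε.le hw0.le, hw3]
  have hεα : 0 < ε ^ α := Real.rpow_pos_of_pos hε _
  have hwα : 0 < w ^ α := Real.rpow_pos_of_pos hw0 _
  field_simp

lemma num_final {v ε θ N s F e : ℝ} (hv : 0 < v) (hε : 0 < ε) (hε1 : ε ≤ 1) (hs : 0 < s)
    (hθ : ε / 12 ≤ θ) (hF0 : 0 ≤ F) (hF : F ≤ 576 * ε * N) (hN : 0 ≤ N)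
    (hid : N ^ 2 * s ^ (5 - 2 * e) = ε * v) :
    4 * v * F ^ 2 / (s⁻¹ * (θ * v)) ^ 2 ≤ 191102976 / s ^ (3 - 2 * e) := by
  have hsp : 0 < s ^ (3 - 2 * e) := Real.rpow_pos_of_pos hs _
  have hs5 : s ^ (5 - 2 * e) = s ^ 2 * s ^ (3 - 2 * e) := by
    rw [← Real.rpow_natCast, ← Real.rpow_add hs]; congr 1; norm_num; ring
  rw [hs5] at hid
  have hθ0 : 0 < θ := lt_of_lt_of_le (by positivity) hθ
  rw [div_le_div_iff₀ (by positivity) hsp]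
  have hF2 : F ^ 2 ≤ (576 * ε * N) ^ 2 := by gcongr
  have hθ2 : (ε / 12) ^ 2 ≤ θ ^ 2 := by gcongr
  have hNs : N ^ 2 * s ^ (3 - 2 * e) = ε * v / s ^ 2 := by
    rw [eq_div_iff (by positivity)]; linarith
  calc 4 * v * F ^ 2 * s ^ (3 - 2 * e) ≤ 4 * v * (576 * ε * N) ^ 2 * s ^ (3 - 2 * e) := by gcongr
    _ = 4 * 576 ^ 2 * v * ε ^ 2 * (N ^ 2 * s ^ (3 - 2 * e)) := by ring
    _ = 4 * 576 ^ 2 * v ^ 2 * ε ^ 2 / s ^ 2 * ε := by rw [hNs]; ring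
    _ ≤ 4 * 576 ^ 2 * v ^ 2 * ε ^ 2 / s ^ 2 * 1 := by gcongr
    _ = 191102976 * (s⁻¹ ^ 2 * ((ε / 12) ^ 2 * v ^ 2)) := by
        rw [inv_pow]; field_simp; norm_num
    _ ≤ 191102976 * (s⁻¹ ^ 2 * (θ ^ 2 * v ^ 2)) := by gcongr
    _ = _ := by ring

end PercAux

open Percolation PercAux in
theorem final_aux :
    ∃ b₀ : ℝ, 0 < b₀ ∧
      ∀ lam α : ℝ, 0 < lam → 0 < α → α < 1 →
      ∀ η : ℝ, η = (1 : ℝ) / 3 * (3 - 2 * α) / (5 - 2 * α) →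
      ∃ b₁₁ b₁₂ : ℝ, 0 < b₁₁ ∧ 0 < b₁₂ ∧
        ∀ (V : Type) [Fintype V] [DecidableEq V]
          (G : SimpleGraph V) [DecidableRel G.Adj],
          G.Connected → IsTransitive G →
          ∀ Ω : ℕ, G.IsRegularOfDegree Ω →
          ∀ (x₀ : V),
          1 < lam * (Fintype.card V : ℝ) ^ ((1 : ℝ) / 3) →
          lam * (Fintype.card V : ℝ) ^ ((1 : ℝ) / 3) < (Fintype.card V : ℝ) →
          b₀⁻¹ ≤ lam * (Fintype.card V : ℝ) ^ ((1 : ℝ) / 3) →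
          ∀ pc : ℝ, 0 < pc → pc < 1 →
          chi G x₀ pc = lam * (Fintype.card V : ℝ) ^ ((1 : ℝ) / 3) →
          ∀ a₀ : ℝ, a₀ ≤ b₀ →
          (∀ x y : V, triangle G pc x y ≤ kron x y + a₀) →
          ∀ ε p : ℝ, p = pc + ε * (Ω : ℝ)⁻¹ → p ≤ 1 →
          max (b₁₂ * ((Fintype.card V : ℝ) ^ ((1 : ℝ) / 3))⁻¹)
              (((Fintype.card V : ℝ) ^ η)⁻¹) ≤ ε → ε ≤ 1 →
          ∀ Nα : ℝ,
            Nα = (ε ^ 2)⁻¹ * (ε * (Fintype.card V : ℝ) ^ ((1 : ℝ) / 3)) ^ α →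
          prob G p (fun ω =>
              (maxCluster G ω : ℝ) ≤
                (1 + (ε * (Fintype.card V : ℝ) ^ η)⁻¹) *
                  Pgeq G x₀ p Nα * (Fintype.card V : ℝ)) ≥
            1 - b₁₁ / (ε * (Fintype.card V : ℝ) ^ η) ^ (3 - 2 * α) := by
  refine ⟨1 / 8, by norm_num, ?_⟩
  intro lam α hlam hα0 hα1 η hη
  refine ⟨191102976, max 12 ((15925248 / lam) ^ (1 / (1 - α))), by norm_num,
    lt_of_lt_of_le (by norm_num) (le_max_left _ _), ?_⟩
  intro V _ _ G _ _ htrans Ω hreg o _ _ hb pc hpc0 hpc1 hchi a₀ ha₀ htri ε p hp _ hmax hε1 N hN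
  have hv : (0 : ℝ) < Fintype.card V := by
    exact_mod_cast Fintype.card_pos_iff.2 ⟨o⟩
  have hXchi : X G pc o = lam * (Fintype.card V : ℝ) ^ ((1 : ℝ) / 3) := by
    rw [← hchi]; exact (bridge_Ex pc _).symm
  have hc : Crit G (Ω : ℝ) pc o := by
    refine ⟨htrans, ?_, hpc0, hpc1, ?_, ?_⟩
    · intro u
      have h := hreg u
      rw [← h, ← SimpleGraph.card_neighborFinset_eq_degree, ← sum_ind_mem]
      apply Finset.sum_congr rfl
      intro v _
      apply ind_congr
      rw [SimpleGraph.mem_neighborFinset]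
    · intro u v huv
      have h := htri u v
      unfold triangle kron at h
      rw [if_neg huv.ne] at h
      simp only [bridge_tau] at h
      linarith
    · rw [hXchi]; norm_num at hb; linarith
  set v : ℝ := (Fintype.card V : ℝ) with hvdef
  set w := v ^ ((1 : ℝ) / 3) with hw
  have hw0 : 0 < w := Real.rpow_pos_of_pos hv _
  have hw3 : w ^ 3 = v := by
    rw [hw, ← Real.rpow_mul_natCast hv.le]; norm_num
  have hε : 0 < ε := lt_of_lt_of_le (by positivity) ((le_max_right _ _).trans hmax)
  have hu := (le_max_left _ _).trans hmax
  rw [← div_eq_mul_inv, div_le_iff₀ hw0] at hu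
  set u := ε * w with hudef
  have hu12 : 12 ≤ u := (le_max_left _ _).trans hu
  have huK : (15925248 / lam) ^ (1 / (1 - α)) ≤ u := (le_max_right _ _).trans hu
  have huα1 : 1 ≤ u ^ α := Real.one_le_rpow (by linarith) hα0.le
  have huα2 : u ^ α ≤ u := by
    calc u ^ α ≤ u ^ (1 : ℝ) := Real.rpow_le_rpow_of_exponent_le (by linarith) hα1.le
      _ = u := Real.rpow_one u
  have hKu : 15925248 * u ^ α ≤ lam * u := by
    have h1 : 15925248 / lam ≤ u ^ (1 - α) := by
      have := Real.rpow_le_rpow (by positivity) huK (show 0 ≤ 1 - α by linarith)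
      rwa [← Real.rpow_mul (by positivity), one_div_mul_cancel (by linarith), Real.rpow_one] at this
    rw [div_le_iff₀ hlam] at h1
    have h2 : u ^ (1 - α) * u ^ α = u := by
      rw [← Real.rpow_add (by linarith)]; norm_num
    calc 15925248 * u ^ α ≤ u ^ (1 - α) * lam * u ^ α := by gcongr
      _ = lam * (u ^ (1 - α) * u ^ α) := by ring
      _ = lam * u := by rw [h2]
  have hpe : p = pc + ε / (Ω : ℝ) := by rw [hp, div_eq_mul_inv]
  have hεN : ε ^ 2 * N = u ^ α := by rw [hN]; field_simp
  have hN1 : 1 ≤ N := by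
    have h0 : 0 ≤ N := by rw [hN]; positivity
    have h2 : ε ^ 2 ≤ 1 := pow_le_one₀ hε.le hε1
    nlinarith [mul_le_mul_of_nonneg_right h2 h0]
  have hNl : 1 / (144 * ε ^ 2) ≤ N := by
    rw [div_le_iff₀ (by positivity)]; nlinarith
  have hFb := hc.F_bound hε hε1 hNl
  have hF : F G (pc + ε / Ω) (6912 * N) o ≤ X G pc o / 4 := by
    refine (hc.F_bound hε hε1 (by linarith)).trans ?_
    rw [hXchi]
    have h1 : 15925248 * (ε ^ 2 * N) ≤ lam * (ε * w) := by rw [hεN]; exact hKu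
    have h2 : ε * (15925248 * (ε * N)) ≤ ε * (lam * w) := by nlinarith
    have h3 := le_of_mul_le_mul_left h2 hε
    linarith
  have hθ := theta_lower hc hε hε1 hN1 hNl hF
  set θ := Pr (pc + ε / Ω) (fun ω : Cf G => N ≤ ((Cl ω o).card : ℝ)) with hθdef
  have hNθ : N ≤ θ * v := by
    have h1 : ε ^ 2 * (12 * N) ≤ ε ^ 2 * (ε * v) := by
      calc ε ^ 2 * (12 * N) = 12 * u ^ α := by rw [← hεN]; ring
        _ ≤ 12 * u := by linarith
        _ ≤ u ^ 3 := by nlinarith [sq_nonneg u]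
        _ = ε ^ 2 * (ε * v) := by rw [hudef, ← hw3]; ring
    have h2 := le_of_mul_le_mul_left h1 (by positivity)
    have h3 : ε / 12 * v ≤ θ * v := by gcongr
    linarith
  have hs : 0 < ε * v ^ η := mul_pos hε (Real.rpow_pos_of_pos hv _)
  have hmain := upper_main hc hε hε1 hN1 (inv_pos.2 hs) hNθ
  have hp2 := hc.p_half hε1
  have hFn : 0 ≤ F G (pc + ε / Ω) N o :=
    F_nonneg (by have : 0 ≤ ε / (Ω : ℝ) := by positivity
                 linarith) (by linarith) (by linarith) o
  have hid := num_id hv hε hα1 hη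
  rw [← hw, ← hudef, ← hN] at hid
  have hnum := num_final hv hε hε1 hs hθ hFn hFb (by linarith) hid
  have hPg : Pgeq G o p N = θ := by
    rw [hpe]; exact bridge_Pr _ _
  rw [hPg, hpe]
  refine le_trans (le_trans ?_ hmain) (le_of_eq (bridge_Pr _ _).symm)
  rw [← hvdef, ← hθdef]
  linarith

open Percolation in
/-- Theorem 1.6(ii) (The percolation probability): upper bound on the
largest supercritical cluster in terms of `θ_α(p)`. -/
theorem supercritical_largest_cluster_upper_bound :
    ∃ b₀ : ℝ, 0 < b₀ ∧
      ∀ lam α : ℝ, 0 < lam → 0 < α → α < 1 →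
      ∀ η : ℝ, η = (1 : ℝ) / 3 * (3 - 2 * α) / (5 - 2 * α) →
      ∃ b₁₁ b₁₂ : ℝ, 0 < b₁₁ ∧ 0 < b₁₂ ∧
        ∀ (V : Type) [Fintype V] [DecidableEq V]
          (G : SimpleGraph V) [DecidableRel G.Adj],
          G.Connected → IsTransitive G →
          ∀ Ω : ℕ, G.IsRegularOfDegree Ω →
          ∀ (x₀ : V),
          1 < lam * (Fintype.card V : ℝ) ^ ((1 : ℝ) / 3) →
          lam * (Fintype.card V : ℝ) ^ ((1 : ℝ) / 3) < (Fintype.card V : ℝ) →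
          b₀⁻¹ ≤ lam * (Fintype.card V : ℝ) ^ ((1 : ℝ) / 3) →
          ∀ pc : ℝ, 0 < pc → pc < 1 →
          chi G x₀ pc = lam * (Fintype.card V : ℝ) ^ ((1 : ℝ) / 3) →
          ∀ a₀ : ℝ, a₀ ≤ b₀ →
          (∀ x y : V, triangle G pc x y ≤ kron x y + a₀) →
          ∀ ε p : ℝ, p = pc + ε * (Ω : ℝ)⁻¹ → p ≤ 1 →
          max (b₁₂ * ((Fintype.card V : ℝ) ^ ((1 : ℝ) / 3))⁻¹)
              (((Fintype.card V : ℝ) ^ η)⁻¹) ≤ ε → ε ≤ 1 →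
          ∀ Nα : ℝ,
            Nα = (ε ^ 2)⁻¹ * (ε * (Fintype.card V : ℝ) ^ ((1 : ℝ) / 3)) ^ α →
          prob G p (fun ω =>
              (maxCluster G ω : ℝ) ≤
                (1 + (ε * (Fintype.card V : ℝ) ^ η)⁻¹) *
                  Pgeq G x₀ p Nα * (Fintype.card V : ℝ)) ≥
            1 - b₁₁ / (ε * (Fintype.card V : ℝ) ^ η) ^ (3 - 2 * α) := by
  exact final_aux
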